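/- For every fixed integer k ≥ 1 there exists a constant ρ_k > 0 such that, if X₁,…,Xₙ are independent points uniformly distributed in the unit square [0,1]², P = {X₁,…,Xₙ}, and R_k(n) is the number of triangulations of P that are order-k Delaunay but not order-i Delaunay for any i < k, then liminf_{n→∞} (log₂ E[R_k(n)])/n ≥ ρ_k. -/

import Mathlib

open EuclideanGeometry Set

noncomputable section

/-- Points of the Euclidean plane. -/
abbrev Pt : Type := EuclideanSpace ℝ (Fin 2)

noncomputable instance : DecidableEq Pt := Classical.decEq _

/-- `P` is in general position: no three (distinct) points collinear and
no four (distinct) points concyclic. -/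
def GenPos (P : Set Pt) : Prop :=
  (∀ u v w : Pt, u ∈ P → v ∈ P → w ∈ P → u ≠ v → u ≠ w → v ≠ w →
    ¬ Collinear ℝ ({u, v, w} : Set Pt)) ∧
  (∀ u v w z : Pt, u ∈ P → v ∈ P → w ∈ P → z ∈ P →
    u ≠ v → u ≠ w → u ≠ z → v ≠ w → v ≠ z → w ≠ z →
    ¬ EuclideanGeometry.Cospherical ({u, v, w, z} : Set Pt))

/-- The (closed) triangle spanned by a finite set of points. -/
def triSet (t : Finset Pt) : Set Pt := convexHull ℝ (t : Set Pt)

/-- `T` is a triangulation of `P`: a finite set of triangles with vertices in `P`,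
every point of `P` is a vertex of some triangle, the interiors of the triangles are
pairwise disjoint, and their union is the convex hull of `P`. -/
def IsTriangulation (P : Set Pt) (T : Set (Finset Pt)) : Prop :=
  T.Finite ∧
  (∀ t ∈ T, t.card = 3 ∧ (t : Set Pt) ⊆ P) ∧
  (∀ p ∈ P, ∃ t ∈ T, p ∈ t) ∧
  (T.Pairwise fun t s => interior (triSet t) ∩ interior (triSet s) = ∅) ∧
  (⋃ t ∈ T, triSet t) = convexHull ℝ P

/-- The triangle `t` (with vertex set `t`) is order-`k` Delaunay with respect to `P`:
the open disk bounded by its circumcircle contains at most `k` points of `P`. -/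
def OrderKTri (P : Set Pt) (k : ℕ) (t : Finset Pt) : Prop :=
  ∃ z : Pt, ∃ r : ℝ, (∀ p ∈ t, dist p z = r) ∧ {p ∈ P | dist p z < r}.encard ≤ (k : ℕ∞)

/-- `T` is an order-`k` Delaunay triangulation of `P`. -/
def IsOrderDT (P : Set Pt) (k : ℕ) (T : Set (Finset Pt)) : Prop :=
  IsTriangulation P T ∧ ∀ t ∈ T, OrderKTri P k t

/-- `{u, v}` is an order-`k` Delaunay edge of `P`: some open disk having `u` and `v`
on its boundary circle contains at most `k` points of `P`. -/
def OrderKEdge (P : Set Pt) (k : ℕ) (u v : Pt) : Prop :=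
  ∃ z : Pt, ∃ r : ℝ, dist u z = r ∧ dist v z = r ∧ {p ∈ P | dist p z < r}.encard ≤ (k : ℕ∞)

/-- `{u, v}` is a useful order-`k` Delaunay edge of `P`: some order-`k` Delaunay
triangulation of `P` contains a triangle having `u` and `v` among its vertices
(i.e. having segment `uv` as a side). -/
def UsefulEdge (P : Set Pt) (k : ℕ) (u v : Pt) : Prop :=
  ∃ T, IsOrderDT P k T ∧ ∃ t ∈ T, u ∈ t ∧ v ∈ t

/-- `{u, v}` is a Delaunay edge: it is an edge of the (unique) order-0 Delaunay
triangulation of `P`. -/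
def DelaunayEdge (P : Set Pt) (u v : Pt) : Prop := UsefulEdge P 0 u v

/-- `p` lies strictly to the left of the directed line from `v` to `u`, i.e. the
triple `v, u, p` makes a counterclockwise turn. -/
def ccw (v u p : Pt) : Prop :=
  0 < (u 0 - v 0) * (p 1 - v 1) - (u 1 - v 1) * (p 0 - v 0)


section Probability

open MeasureTheory Filter Real

/-- The unit square `[0,1]²`. -/
def unitSq : Set Pt := {p : Pt | p 0 ∈ Set.Icc (0 : ℝ) 1 ∧ p 1 ∈ Set.Icc (0 : ℝ) 1}

/-- The uniform (probability) distribution on the unit square. -/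
noncomputable def unifSq : Measure Pt := volume.restrict unitSq

/-- The law of `n` independent points, each uniform in the unit square: the product
measure on configurations `Fin n → Pt`. -/
noncomputable def conf (n : ℕ) : Measure (Fin n → Pt) := Measure.pi fun _ => unifSq

/-- The constant `c₁ ≈ 0.23807`. -/
noncomputable def c1 : ℝ :=
  ∫ a in Set.Ioi (0 : ℝ), ∫ c in Set.Ioi a, ∫ b in Set.Ioi a,
    8 * π * a *
      (2 * a * c / Real.sqrt (c ^ 2 - a ^ 2) - 2 * c * Real.arcsin (a / c)) *
      (2 * a * b / Real.sqrt (b ^ 2 - a ^ 2) - 2 * b * Real.arcsin (a / b)) *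
      Real.exp (-π * b ^ 2 + b ^ 2 * Real.arcsin (a / b) - a * Real.sqrt (b ^ 2 - a ^ 2)
        - π * c ^ 2 + c ^ 2 * Real.arcsin (a / c) - a * Real.sqrt (c ^ 2 - a ^ 2))

/-- The constant `c₂ ≈ 0.40675`. -/
noncomputable def c2 : ℝ :=
  ∫ a in Set.Ioi (0 : ℝ), ∫ c in Set.Ioi a, ∫ b in Set.Ioi c,
    8 * π * a *
      (2 * π * c - 2 * c * Real.arcsin (a / c) + 2 * a * c / Real.sqrt (c ^ 2 - a ^ 2)) *
      (2 * a * b / Real.sqrt (b ^ 2 - a ^ 2) - 2 * b * Real.arcsin (a / b)) *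
      Real.exp (-π * b ^ 2 + b ^ 2 * Real.arcsin (a / b) - a * Real.sqrt (b ^ 2 - a ^ 2)
        - c ^ 2 * Real.arcsin (a / c) + a * Real.sqrt (c ^ 2 - a ^ 2))

end Probability

/-! ### Orientation, circumcircles and triangles -/

/-- Twice the signed area of the triangle `a b c`. -/
def orient (a b c : Pt) : ℝ := (b 0 - a 0) * (c 1 - a 1) - (b 1 - a 1) * (c 0 - a 0)

/-- The squared norm of a point. -/
def nsq (p : Pt) : ℝ := p 0 ^ 2 + p 1 ^ 2

/-- The in-circle polynomial: `orient a b c` times the power of `p` with respect to the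
circle through `a`, `b`, `c`. -/
def inCirc (a b c p : Pt) : ℝ :=
  orient a b c * nsq p - orient p b c * nsq a - orient a p c * nsq b - orient a b p * nsq c

lemma dist_sq_eq (p z : Pt) : dist p z ^ 2 = (p 0 - z 0) ^ 2 + (p 1 - z 1) ^ 2 := by
  rw [EuclideanSpace.dist_eq, Real.sq_sqrt (by positivity), Fin.sum_univ_two, Real.dist_eq,
    Real.dist_eq, sq_abs, sq_abs]

lemma inCirc_eq_orient_mul {a b c z : Pt} {r : ℝ} (ha : dist a z = r) (hb : dist b z = r)
    (hc : dist c z = r) (p : Pt) :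
    inCirc a b c p = orient a b c * (dist p z ^ 2 - r ^ 2) := by
  have ha' := dist_sq_eq a z
  have hb' := dist_sq_eq b z
  have hc' := dist_sq_eq c z
  rw [ha] at ha'
  rw [hb] at hb'
  rw [hc] at hc'
  rw [dist_sq_eq]
  unfold inCirc nsq orient
  linear_combination
    ((b 0 - p 0) * (c 1 - p 1) - (b 1 - p 1) * (c 0 - p 0)) * ha' +
    ((p 0 - a 0) * (c 1 - a 1) - (p 1 - a 1) * (c 0 - a 0)) * hb' +
    ((b 0 - a 0) * (p 1 - a 1) - (b 1 - a 1) * (p 0 - a 0)) * hc'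

lemma exists_circumcenter {a b c : Pt} (h : orient a b c ≠ 0) :
    ∃ z : Pt, ∃ r : ℝ, dist a z = r ∧ dist b z = r ∧ dist c z = r := by
  let z : Pt := !₂[((nsq b - nsq a) * (c 1 - a 1) - (nsq c - nsq a) * (b 1 - a 1)) /
      (2 * orient a b c),
    ((nsq c - nsq a) * (b 0 - a 0) - (nsq b - nsq a) * (c 0 - a 0)) / (2 * orient a b c)]
  have h0 : 2 * orient a b c * z 0 =
      (nsq b - nsq a) * (c 1 - a 1) - (nsq c - nsq a) * (b 1 - a 1) := by
    simp only [z, Matrix.cons_val_zero]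
    field_simp
  have h1 : 2 * orient a b c * z 1 =
      (nsq c - nsq a) * (b 0 - a 0) - (nsq b - nsq a) * (c 0 - a 0) := by
    simp only [z, Matrix.cons_val_one, Matrix.cons_val_fin_one]
    field_simp
  have key : ∀ p : Pt, orient a b c * (dist p z ^ 2 - dist a z ^ 2) = 0 → dist p z = dist a z := by
    intro p hp
    have := (mul_eq_zero.1 hp).resolve_left h
    exact (sq_eq_sq₀ dist_nonneg dist_nonneg).1 (by linarith)
  refine ⟨z, dist a z, rfl, key b ?_, key c ?_⟩
  · rw [dist_sq_eq, dist_sq_eq]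
    unfold nsq at h0 h1
    unfold orient at h0 h1 ⊢
    linear_combination (a 0 - b 0) * h0 + (a 1 - b 1) * h1
  · rw [dist_sq_eq, dist_sq_eq]
    unfold nsq at h0 h1
    unfold orient at h0 h1 ⊢
    linear_combination (a 0 - c 0) * h0 + (a 1 - c 1) * h1

lemma dist_lt_iff_inCirc {a b c z : Pt} {r : ℝ} (h : orient a b c ≠ 0) (ha : dist a z = r)
    (hb : dist b z = r) (hc : dist c z = r) (p : Pt) :
    dist p z < r ↔ orient a b c * inCirc a b c p < 0 := by
  have hr : 0 ≤ r := ha ▸ dist_nonneg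
  rw [inCirc_eq_orient_mul ha hb hc, ← mul_assoc, ← sq_lt_sq₀ dist_nonneg hr]
  have : 0 < orient a b c * orient a b c := mul_self_pos.2 h
  constructor
  · intro h'
    exact mul_neg_of_pos_of_neg this (by linarith)
  · intro h'
    nlinarith

lemma orderKTri_iff {a b c : Pt} (h : orient a b c ≠ 0) (P : Set Pt) (k : ℕ) :
    OrderKTri P k {a, b, c} ↔
      {p ∈ P | orient a b c * inCirc a b c p < 0}.encard ≤ (k : ℕ∞) := by
  constructor
  · rintro ⟨z, r, hz, hk⟩
    have ha := hz a (by simp)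
    have hb := hz b (by simp)
    have hc := hz c (by simp)
    simpa only [dist_lt_iff_inCirc h ha hb hc] using hk
  · intro hk
    obtain ⟨z, r, ha, hb, hc⟩ := exists_circumcenter h
    refine ⟨z, r, by simp [ha, hb, hc], ?_⟩
    simpa only [dist_lt_iff_inCirc h ha hb hc] using hk

lemma orient_combo {a b c q : Pt} (h : orient a b c ≠ 0) :
    (orient q b c / orient a b c) • a + (orient a q c / orient a b c) • b +
      (orient a b q / orient a b c) • c = q := by
  ext i
  fin_cases i
  all_goals
    simp only [PiLp.add_apply, PiLp.smul_apply, smul_eq_mul, Fin.mk_one, Fin.zero_eta]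
    field_simp
    unfold orient
    ring

lemma orient_sum (a b c q : Pt) :
    orient q b c + orient a q c + orient a b q = orient a b c := by
  unfold orient; ring

lemma mem_triSet_iff {a b c q : Pt} (h : orient a b c ≠ 0) :
    q ∈ triSet {a, b, c} ↔ 0 ≤ orient a b c * orient q b c ∧ 0 ≤ orient a b c * orient a q c ∧
      0 ≤ orient a b c * orient a b q := by
  constructor
  · intro hq
    have hconv : Convex ℝ {q : Pt | 0 ≤ orient a b c * orient q b c ∧
        0 ≤ orient a b c * orient a q c ∧ 0 ≤ orient a b c * orient a b q} := by
      rintro x ⟨hx1, hx2, hx3⟩ y ⟨hy1, hy2, hy3⟩ s t hs ht hst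
      obtain rfl : t = 1 - s := by linarith
      have e1 : orient (s • x + (1 - s) • y) b c = s * orient x b c + (1 - s) * orient y b c := by
        simp only [orient, PiLp.add_apply, PiLp.smul_apply, smul_eq_mul]; ring
      have e2 : orient a (s • x + (1 - s) • y) c = s * orient a x c + (1 - s) * orient a y c := by
        simp only [orient, PiLp.add_apply, PiLp.smul_apply, smul_eq_mul]; ring
      have e3 : orient a b (s • x + (1 - s) • y) = s * orient a b x + (1 - s) * orient a b y := by
        simp only [orient, PiLp.add_apply, PiLp.smul_apply, smul_eq_mul]; ring
      simp only [mem_ofPred_eq, e1, e2, e3]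
      refine ⟨?_, ?_, ?_⟩ <;>
        nlinarith [mul_nonneg hs hx1, mul_nonneg ht hy1, mul_nonneg hs hx2, mul_nonneg ht hy2,
          mul_nonneg hs hx3, mul_nonneg ht hy3]
    refine convexHull_min ?_ hconv hq
    have hsq := mul_self_nonneg (orient a b c)
    have z1 : ∀ x y : Pt, orient x x y = 0 := fun x y => by unfold orient; ring
    have z2 : ∀ x y : Pt, orient x y y = 0 := fun x y => by unfold orient; ring
    have z3 : ∀ x y : Pt, orient x y x = 0 := fun x y => by unfold orient; ring
    intro p hp
    simp only [Finset.coe_insert, Finset.coe_singleton, mem_insert_iff, mem_singleton_iff] at hp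
    rcases hp with rfl | rfl | rfl <;> simp [z1, z2, z3, hsq]
  · rintro ⟨h1, h2, h3⟩
    have hpos : 0 < orient a b c * orient a b c := mul_self_pos.2 h
    have conv : ∀ x, 0 ≤ orient a b c * x → 0 ≤ x / orient a b c := by
      intro x hx
      have : x / orient a b c = (orient a b c * x) / (orient a b c * orient a b c) := by
        field_simp
      rw [this]; positivity
    rw [← orient_combo (q := q) h]
    have := (convex_convexHull ℝ (({a, b, c} : Finset Pt) : Set Pt)).sum_mem
      (t := Finset.univ) (w := ![orient q b c / orient a b c, orient a q c / orient a b c,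
        orient a b q / orient a b c]) (z := ![a, b, c]) ?_ ?_ ?_
    · simpa [Fin.sum_univ_three, triSet] using this
    · intro i _
      fin_cases i
      · exact conv _ h1
      · exact conv _ h2
      · exact conv _ h3
    · simp only [Fin.sum_univ_three, Matrix.cons_val_zero, Matrix.cons_val_one, Matrix.cons_val]
      rw [← add_div, ← add_div, orient_sum, div_self h]
    · intro i _
      apply subset_convexHull
      fin_cases i <;> simp

lemma continuous_orient {X : Type*} [TopologicalSpace X] {f g h : X → Pt} (hf : Continuous f)
    (hg : Continuous g) (hh : Continuous h) : Continuous fun x => orient (f x) (g x) (h x) := by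
  unfold orient; fun_prop

lemma continuous_inCirc {X : Type*} [TopologicalSpace X] {f g h p : X → Pt} (hf : Continuous f)
    (hg : Continuous g) (hh : Continuous h) (hp : Continuous p) :
    Continuous fun x => inCirc (f x) (g x) (h x) (p x) := by
  unfold inCirc nsq orient; fun_prop

/-- Every open set around `q` contains points displaced from `q` in a prescribed direction. -/
lemma exists_pos_add_smul_mem {U : Set Pt} (hU : IsOpen U) {q : Pt} (hq : q ∈ U) (v : Pt) :
    ∃ s : ℝ, 0 < s ∧ q + s • v ∈ U := by
  have hc : Continuous fun s : ℝ => q + s • v := by fun_prop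
  have hev : ∀ᶠ s in nhdsWithin (0 : ℝ) (Ioi 0), q + s • v ∈ U :=
    nhdsWithin_le_nhds (hc.continuousAt.eventually_mem (hU.mem_nhds (by simpa using hq)))
  obtain ⟨s, hs, hs0⟩ := (hev.and self_mem_nhdsWithin).exists
  exact ⟨s, hs0, hs⟩

lemma mem_interior_triSet_iff {a b c q : Pt} (h : orient a b c ≠ 0) :
    q ∈ interior (triSet {a, b, c}) ↔ 0 < orient a b c * orient q b c ∧
      0 < orient a b c * orient a q c ∧ 0 < orient a b c * orient a b q := by
  have hpos : 0 < orient a b c * orient a b c := mul_self_pos.2 h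
  constructor
  · intro hq
    have hmem := (mem_triSet_iff h).1 (interior_subset hq)
    refine ⟨hmem.1.lt_of_ne' fun h0 => ?_, hmem.2.1.lt_of_ne' fun h0 => ?_,
      hmem.2.2.lt_of_ne' fun h0 => ?_⟩
    · obtain ⟨s, hs, hm⟩ := exists_pos_add_smul_mem isOpen_interior hq (b - a)
      have := ((mem_triSet_iff h).1 (interior_subset hm)).1
      have e : orient a b c * orient (q + s • (b - a)) b c =
          orient a b c * orient q b c - s * (orient a b c * orient a b c) := by
        simp only [orient, PiLp.add_apply, PiLp.smul_apply, PiLp.sub_apply, smul_eq_mul]; ring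
      rw [e, h0] at this
      nlinarith
    · obtain ⟨s, hs, hm⟩ := exists_pos_add_smul_mem isOpen_interior hq (c - b)
      have := ((mem_triSet_iff h).1 (interior_subset hm)).2.1
      have e : orient a b c * orient a (q + s • (c - b)) c =
          orient a b c * orient a q c - s * (orient a b c * orient a b c) := by
        simp only [orient, PiLp.add_apply, PiLp.smul_apply, PiLp.sub_apply, smul_eq_mul]; ring
      rw [e, h0] at this
      nlinarith
    · obtain ⟨s, hs, hm⟩ := exists_pos_add_smul_mem isOpen_interior hq (a - c)
      have := ((mem_triSet_iff h).1 (interior_subset hm)).2.2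
      have e : orient a b c * orient a b (q + s • (a - c)) =
          orient a b c * orient a b q - s * (orient a b c * orient a b c) := by
        simp only [orient, PiLp.add_apply, PiLp.smul_apply, PiLp.sub_apply, smul_eq_mul]; ring
      rw [e, h0] at this
      nlinarith
  · intro hq
    refine mem_interior.2 ⟨{q | 0 < orient a b c * orient q b c ∧
      0 < orient a b c * orient a q c ∧ 0 < orient a b c * orient a b q}, ?_, ?_, hq⟩
    · rintro p ⟨h1, h2, h3⟩
      exact (mem_triSet_iff h).2 ⟨h1.le, h2.le, h3.le⟩
    · have c1 : Continuous fun q => orient q b c :=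
        continuous_orient continuous_id continuous_const continuous_const
      have c2 : Continuous fun q => orient a q c :=
        continuous_orient continuous_const continuous_id continuous_const
      have c3 : Continuous fun q => orient a b q :=
        continuous_orient continuous_const continuous_const continuous_id
      exact (isOpen_lt continuous_const (continuous_const.mul c1)).inter
        ((isOpen_lt continuous_const (continuous_const.mul c2)).inter
          (isOpen_lt continuous_const (continuous_const.mul c3)))

lemma mem_triSet_of_pos {a b c q : Pt} (h : 0 < orient a b c) :
    q ∈ triSet {a, b, c} ↔ 0 ≤ orient q b c ∧ 0 ≤ orient a q c ∧ 0 ≤ orient a b q := by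
  simp only [mem_triSet_iff h.ne', mul_nonneg_iff_of_pos_left h]

lemma mem_interior_triSet_of_pos {a b c q : Pt} (h : 0 < orient a b c) :
    q ∈ interior (triSet {a, b, c}) ↔ 0 < orient q b c ∧ 0 < orient a q c ∧ 0 < orient a b q := by
  simp only [mem_interior_triSet_iff h.ne', mul_pos_iff_of_pos_left h]

/-! ### The Delaunay triangulation -/

/-- A finite planar point set in general position, phrased with polynomial conditions. -/
structure Generic (P : Set Pt) : Prop where
  finite : P.Finite
  orient_ne : ∀ a ∈ P, ∀ b ∈ P, ∀ c ∈ P, a ≠ b → a ≠ c → b ≠ c → orient a b c ≠ 0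
  inCirc_ne : ∀ a ∈ P, ∀ b ∈ P, ∀ c ∈ P, ∀ d ∈ P, a ≠ b → a ≠ c → a ≠ d → b ≠ c → b ≠ d →
    c ≠ d → inCirc a b c d ≠ 0

/-- The triangles of `P` whose open circumdisk contains no point of `P`. -/
def delaunayTris (P : Set Pt) : Set (Finset Pt) :=
  {t | t.card = 3 ∧ (t : Set Pt) ⊆ P ∧ OrderKTri P 0 t}

lemma orient_swap (a b c : Pt) : orient a c b = -orient a b c := by unfold orient; ring

lemma orient_rotate (a b c : Pt) : orient b c a = orient a b c := by unfold orient; ring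

lemma inCirc_rotate (a b c p : Pt) : inCirc b c a p = inCirc a b c p := by
  unfold inCirc orient; ring

lemma ne_of_orient_ne_zero {a b c : Pt} (h : orient a b c ≠ 0) : a ≠ b ∧ a ≠ c ∧ b ≠ c := by
  refine ⟨?_, ?_, ?_⟩ <;> rintro rfl <;> apply h <;> unfold orient <;> ring

lemma card_triple {a b c : Pt} (h : orient a b c ≠ 0) : ({a, b, c} : Finset Pt).card = 3 := by
  obtain ⟨h1, h2, h3⟩ := ne_of_orient_ne_zero h
  exact Finset.card_eq_three.2 ⟨a, b, c, h1, h2, h3, rfl⟩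

lemma triple_subset {P : Set Pt} {a b c : Pt} (ha : a ∈ P) (hb : b ∈ P) (hc : c ∈ P) :
    ((({a, b, c} : Finset Pt)) : Set Pt) ⊆ P := by
  simp [insert_subset_iff, ha, hb, hc]

lemma OrderKTri.mono {P : Set Pt} {i j : ℕ} (hij : i ≤ j) {t : Finset Pt} (h : OrderKTri P i t) :
    OrderKTri P j t := by
  obtain ⟨z, r, hz, hc⟩ := h
  exact ⟨z, r, hz, hc.trans (by exact_mod_cast hij)⟩

namespace Generic

variable {P : Set Pt}

lemma exists_pos_orient (hP : Generic P) {t : Finset Pt} (ht : t.card = 3)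
    (htP : (t : Set Pt) ⊆ P) :
    ∃ a b c, t = {a, b, c} ∧ 0 < orient a b c ∧ a ∈ P ∧ b ∈ P ∧ c ∈ P := by
  obtain ⟨a, b, c, hab, hac, hbc, rfl⟩ := Finset.card_eq_three.1 ht
  have ha : a ∈ P := htP (by simp)
  have hb : b ∈ P := htP (by simp)
  have hc : c ∈ P := htP (by simp)
  rcases (hP.orient_ne a ha b hb c hc hab hac hbc).lt_or_gt with h | h
  · refine ⟨a, c, b, ?_, ?_, ha, hc, hb⟩
    · ext x; simp; tauto
    · rw [orient_swap]; linarith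
  · exact ⟨a, b, c, rfl, h, ha, hb, hc⟩

lemma inCirc_eq_zero (hP : Generic P) {a b c p : Pt} (h : orient a b c ≠ 0) (ha : a ∈ P)
    (hb : b ∈ P) (hc : c ∈ P) (hp : p ∈ P) (h0 : inCirc a b c p = 0) :
    p ∈ ({a, b, c} : Finset Pt) := by
  obtain ⟨h1, h2, h3⟩ := ne_of_orient_ne_zero h
  by_contra hmem
  simp only [Finset.mem_insert, Finset.mem_singleton, not_or] at hmem
  exact hP.inCirc_ne a ha b hb c hc p hp h1 h2 (Ne.symm hmem.1) h3 (Ne.symm hmem.2.1)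
    (Ne.symm hmem.2.2) h0

end Generic

lemma orderKTri_zero_iff {P : Set Pt} {a b c : Pt} (h : 0 < orient a b c) :
    OrderKTri P 0 {a, b, c} ↔ ∀ p ∈ P, 0 ≤ inCirc a b c p := by
  rw [orderKTri_iff h.ne']
  simp only [Nat.cast_zero, nonpos_iff_eq_zero, encard_eq_zero, eq_empty_iff_forall_notMem,
    mem_ofPred_eq, not_and, not_lt, mul_nonneg_iff_of_pos_left h]

lemma inCirc_expand (a b c : Pt) :
    ∃ u v w : ℝ, ∀ p, inCirc a b c p = orient a b c * nsq p + u * p 0 + v * p 1 + w := by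
  refine ⟨(c 1 - b 1) * nsq a - (c 1 - a 1) * nsq b + (b 1 - a 1) * nsq c,
    (b 0 - c 0) * nsq a - (a 0 - c 0) * nsq b + (a 0 - b 0) * nsq c,
    -((b 0 * c 1 - b 1 * c 0) * nsq a - (a 0 * c 1 - a 1 * c 0) * nsq b
      + (a 0 * b 1 - a 1 * b 0) * nsq c), fun p => ?_⟩
  unfold inCirc orient; ring

lemma triSet_subset {P : Set Pt} {t : Finset Pt} (h : (t : Set Pt) ⊆ P) :
    triSet t ⊆ convexHull ℝ P := convexHull_mono h

/-- Two distinct empty-circumdisk triangles of a generic set have disjoint interiors. -/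
lemma delaunayTris_disjoint {P : Set Pt} (hP : Generic P) {t s : Finset Pt}
    (ht : t ∈ delaunayTris P) (hs : s ∈ delaunayTris P) (hne : t ≠ s) :
    interior (triSet t) ∩ interior (triSet s) = ∅ := by
  obtain ⟨ht3, htP, hto⟩ := ht
  obtain ⟨hs3, hsP, hso⟩ := hs
  obtain ⟨a, b, c, rfl, h1, ha, hb, hc⟩ := hP.exists_pos_orient ht3 htP
  obtain ⟨a', b', c', rfl, h2, ha', hb', hc'⟩ := hP.exists_pos_orient hs3 hsP
  rw [orderKTri_zero_iff h1] at hto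
  rw [orderKTri_zero_iff h2] at hso
  rw [eq_empty_iff_forall_notMem]
  rintro q ⟨hq1, hq2⟩
  rw [mem_interior_triSet_of_pos h1] at hq1
  rw [mem_interior_triSet_of_pos h2] at hq2
  -- the difference of the two power functions, scaled by both orientations
  let f : Pt → ℝ := fun p =>
    orient a' b' c' * inCirc a b c p - orient a b c * inCirc a' b' c' p
  obtain ⟨u, v, w, hf⟩ : ∃ u v w : ℝ, ∀ p, f p = u * p 0 + v * p 1 + w := by
    obtain ⟨u, v, w, h⟩ := inCirc_expand a b c
    obtain ⟨u', v', w', h'⟩ := inCirc_expand a' b' c'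
    refine ⟨orient a' b' c' * u - orient a b c * u', orient a' b' c' * v - orient a b c * v',
      orient a' b' c' * w - orient a b c * w', fun p => ?_⟩
    simp only [f, h, h']; ring
  have hf1 : orient a b c * f q =
      orient q b c * f a + orient a q c * f b + orient a b q * f c := by
    simp only [hf, orient]; ring
  have hf2 : orient a' b' c' * f q =
      orient q b' c' * f a' + orient a' q c' * f b' + orient a' b' q * f c' := by
    simp only [hf, orient]; ring
  have z1 : inCirc a b c a = 0 ∧ inCirc a b c b = 0 ∧ inCirc a b c c = 0 := by
    refine ⟨?_, ?_, ?_⟩ <;> simp only [inCirc, orient] <;> ring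
  have z2 : inCirc a' b' c' a' = 0 ∧ inCirc a' b' c' b' = 0 ∧ inCirc a' b' c' c' = 0 := by
    refine ⟨?_, ?_, ?_⟩ <;> simp only [inCirc, orient] <;> ring
  have g1 : ∀ p ∈ P, inCirc a b c p = 0 → f p ≤ 0 := by
    intro p hp h0
    have := mul_nonneg h1.le (hso p hp)
    simp only [f, h0]; linarith
  have g2 : ∀ p ∈ P, inCirc a' b' c' p = 0 → 0 ≤ f p := by
    intro p hp h0
    have := mul_nonneg h2.le (hto p hp)
    simp only [f, h0]; linarith
  have ga := g1 a ha z1.1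
  have gb := g1 b hb z1.2.1
  have gc := g1 c hc z1.2.2
  have hq0 : 0 ≤ f q := by
    have : 0 ≤ orient a' b' c' * f q := by
      rw [hf2]
      have := mul_nonneg hq2.1.le (g2 a' ha' z2.1)
      have := mul_nonneg hq2.2.1.le (g2 b' hb' z2.2.1)
      have := mul_nonneg hq2.2.2.le (g2 c' hc' z2.2.2)
      linarith
    exact nonneg_of_mul_nonneg_right this h2
  have hq0' : 0 ≤ orient a b c * f q := mul_nonneg h1.le hq0
  have e1 := mul_nonpos_of_nonneg_of_nonpos hq1.1.le ga
  have e2 := mul_nonpos_of_nonneg_of_nonpos hq1.2.1.le gb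
  have e3 := mul_nonpos_of_nonneg_of_nonpos hq1.2.2.le gc
  have fa : f a = 0 := by
    have : orient q b c * f a = 0 := by linarith
    exact (mul_eq_zero.1 this).resolve_left hq1.1.ne'
  have fb : f b = 0 := by
    have : orient a q c * f b = 0 := by linarith
    exact (mul_eq_zero.1 this).resolve_left hq1.2.1.ne'
  have fc : f c = 0 := by
    have : orient a b q * f c = 0 := by linarith
    exact (mul_eq_zero.1 this).resolve_left hq1.2.2.ne'
  have key : ∀ p ∈ P, inCirc a b c p = 0 → f p = 0 → p ∈ ({a', b', c'} : Finset Pt) := by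
    intro p hp h0 hfp
    refine hP.inCirc_eq_zero h2.ne' ha' hb' hc' hp ?_
    have : orient a b c * inCirc a' b' c' p = 0 := by
      simp only [f, h0] at hfp; linarith
    exact (mul_eq_zero.1 this).resolve_left h1.ne'
  apply hne
  apply Finset.eq_of_subset_of_card_le
  · intro p hp
    simp only [Finset.mem_insert, Finset.mem_singleton] at hp
    rcases hp with rfl | rfl | rfl
    · exact key _ ha z1.1 fa
    · exact key _ hb z1.2.1 fb
    · exact key _ hc z1.2.2 fc
  · rw [ht3, hs3]

/-- A point of `P` in an empty-circumdisk triangle is one of its vertices. -/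
lemma mem_of_mem_delaunayTri {P : Set Pt} (hP : Generic P) {t : Finset Pt}
    (ht : t ∈ delaunayTris P) {p : Pt} (hp : p ∈ P) (hpt : p ∈ triSet t) : p ∈ t := by
  obtain ⟨ht3, htP, hto⟩ := ht
  obtain ⟨a, b, c, rfl, h, ha, hb, hc⟩ := hP.exists_pos_orient ht3 htP
  rw [orderKTri_zero_iff h] at hto
  rw [mem_triSet_of_pos h] at hpt
  obtain ⟨h1, h2, h3⟩ := ne_of_orient_ne_zero h.ne'
  by_contra hmem
  simp only [Finset.mem_insert, Finset.mem_singleton, not_or] at hmem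
  have p1 := hpt.1.lt_of_ne' (hP.orient_ne p hp b hb c hc hmem.2.1 hmem.2.2 h3)
  have p2 := hpt.2.1.lt_of_ne' (hP.orient_ne a ha p hp c hc (Ne.symm hmem.1) h2 hmem.2.2)
  have p3 := hpt.2.2.lt_of_ne'
    (hP.orient_ne a ha b hb p hp h1 (Ne.symm hmem.1) (Ne.symm hmem.2.1))
  have hneg := hto p hp
  have hid : orient a b c * inCirc a b c p =
      -(orient p b c * orient a p c * nsq (a - b) + orient a p c * orient a b p * nsq (b - c)
        + orient p b c * orient a b p * nsq (a - c)) := by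
    simp only [inCirc, orient, nsq, PiLp.sub_apply]; ring
  have hab : 0 < nsq (a - b) := by
    have : nsq (a - b) = dist a b ^ 2 := by
      rw [dist_sq_eq]; simp [nsq]
    rw [this]
    exact pow_pos (dist_pos.2 h1) 2
  have n2 : 0 ≤ nsq (b - c) := by unfold nsq; positivity
  have n3 : 0 ≤ nsq (a - c) := by unfold nsq; positivity
  have : 0 < orient p b c * orient a p c * nsq (a - b) := by positivity
  have : 0 ≤ orient a p c * orient a b p * nsq (b - c) := by positivity
  have : 0 ≤ orient p b c * orient a b p * nsq (a - c) := by positivity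
  have := mul_nonneg h.le hneg
  linarith

/-- `q` lies in the interior of the counterclockwise triangle `a b c`. -/
def Encloses (q a b c : Pt) : Prop :=
  0 < orient a b c ∧ 0 < orient q b c ∧ 0 < orient a q c ∧ 0 < orient a b q

/-- The height over `q` of the plane through the lifts of `a`, `b`, `c` to the paraboloid. -/
def liftHeight (q a b c : Pt) : ℝ :=
  (orient q b c * nsq a + orient a q c * nsq b + orient a b q * nsq c) / orient a b c

lemma Encloses.rotate {q a b c : Pt} (h : Encloses q a b c) : Encloses q b c a := by
  obtain ⟨h1, h2, h3, h4⟩ := h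
  refine ⟨by rwa [orient_rotate], ?_, ?_, ?_⟩
  · rwa [← orient_rotate, ← orient_rotate]
  · rwa [orient_rotate]
  · rwa [orient_rotate]

lemma liftHeight_rotate (q a b c : Pt) : liftHeight q b c a = liftHeight q a b c := by
  unfold liftHeight
  rw [orient_rotate a b c]
  congr 1
  unfold orient; ring

/-- If `p` is inside the circumcircle of `a b c` then replacing `a` by `p`, when this keeps
`q` enclosed, lowers the lifted height over `q`. -/
lemma exists_lower {q a b c p : Pt} (h : Encloses q a b c) (hp : inCirc a b c p < 0)
    (hA : 0 < orient p b c)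
    (hB : orient q b c * orient a p c ≤ orient a q c * orient p b c)
    (hC : orient q b c * orient a b p ≤ orient a b q * orient p b c)
    (hpc : orient p c q ≠ 0) (hpb : orient p b q ≠ 0) :
    Encloses q p b c ∧ liftHeight q p b c < liftHeight q a b c := by
  obtain ⟨h1, h2, h3, h4⟩ := h
  have e1 : orient a b c * orient p q c =
      orient a q c * orient p b c - orient q b c * orient a p c := by unfold orient; ring
  have e2 : orient a b c * orient p b q =
      orient a b q * orient p b c - orient q b c * orient a b p := by unfold orient; ring
  have q1 : 0 ≤ orient p q c := nonneg_of_mul_nonneg_right (by linarith) h1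
  have q2 : 0 ≤ orient p b q := nonneg_of_mul_nonneg_right (by linarith) h1
  have q1' : orient p q c ≠ 0 := by
    rw [orient_swap]; exact neg_ne_zero.2 hpc
  refine ⟨⟨hA, h2, q1.lt_of_ne' q1', q2.lt_of_ne' hpb⟩, ?_⟩
  unfold liftHeight
  rw [div_lt_div_iff₀ hA h1]
  have : 0 < orient q b c * (-inCirc a b c p) := mul_pos h2 (by linarith)
  have e3 : (orient q b c * nsq a + orient a q c * nsq b + orient a b q * nsq c) * orient p b c -
      (orient q b c * nsq p + orient p q c * nsq b + orient p b q * nsq c) * orient a b c =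
      orient q b c * (-inCirc a b c p) := by
    unfold inCirc orient; ring
  linarith

lemma exists_max_ratio {α β γ A B C : ℝ} (hα : 0 < α) (hβ : 0 < β) (hγ : 0 < γ)
    (h : 0 < A + B + C) :
    (0 < A ∧ α * B ≤ β * A ∧ α * C ≤ γ * A) ∨ (0 < B ∧ β * C ≤ γ * B ∧ β * A ≤ α * B) ∨
      (0 < C ∧ γ * A ≤ α * C ∧ γ * B ≤ β * C) := by
  have tr : ∀ {x y u v : ℝ}, 0 < x → 0 < u → y / x ≤ v / u → u * y ≤ x * v := by
    intro x y u v hx hu hle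
    rw [div_le_div_iff₀ hx hu] at hle; linarith
  have pos : ∀ {M : ℝ}, A / α ≤ M → B / β ≤ M → C / γ ≤ M → 0 < M := by
    intro M h1 h2 h3
    by_contra hM
    push Not at hM
    have a1 := (div_le_iff₀ hα).1 h1
    have a2 := (div_le_iff₀ hβ).1 h2
    have a3 := (div_le_iff₀ hγ).1 h3
    have := mul_nonpos_of_nonpos_of_nonneg hM hα.le
    have := mul_nonpos_of_nonpos_of_nonneg hM hβ.le
    have := mul_nonpos_of_nonpos_of_nonneg hM hγ.le
    linarith
  have pos' : ∀ {x y : ℝ}, 0 < x → 0 < y / x → 0 < y := by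
    intro x y hx hxy
    exact (div_pos_iff_of_pos_right hx).1 hxy
  rcases le_total (A / α) (B / β) with h1 | h1
  · rcases le_total (B / β) (C / γ) with h2 | h2
    · exact Or.inr (Or.inr ⟨pos' hγ (pos (h1.trans h2) h2 le_rfl), tr hα hγ (h1.trans h2),
        tr hβ hγ h2⟩)
    · exact Or.inr (Or.inl ⟨pos' hβ (pos h1 le_rfl h2), tr hγ hβ h2, tr hα hβ h1⟩)
  · rcases le_total (A / α) (C / γ) with h2 | h2
    · exact Or.inr (Or.inr ⟨pos' hγ (pos h2 (h1.trans h2) le_rfl), tr hα hγ h2,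
        tr hβ hγ (h1.trans h2)⟩)
    · exact Or.inl ⟨pos' hα (pos le_rfl h1 h2), tr hβ hα h1, tr hγ hα h2⟩

/-- Carathéodory for points off all lines spanned by `P`. -/
lemma exists_encloses {P : Set Pt} (hP2 : P.Nontrivial) {q : Pt} (hq : q ∈ convexHull ℝ P)
    (hgen : ∀ a ∈ P, ∀ b ∈ P, a ≠ b → orient a b q ≠ 0) :
    ∃ a ∈ P, ∃ b ∈ P, ∃ c ∈ P, Encloses q a b c := by
  obtain ⟨ι, _, z, w, hz, hind, hw, hsum, hcomb⟩ := eq_pos_convex_span_of_mem_convexHull hq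
  have hcard : Fintype.card ι ≤ 3 := by
    have h1 := hind.card_le_finrank_succ
    have h2 : Module.finrank ℝ (vectorSpan ℝ (range z)) ≤ 2 := by
      have := Submodule.finrank_le (vectorSpan ℝ (range z))
      simpa using this
    omega
  obtain ⟨m, hm⟩ : ∃ m, m = Fintype.card ι := ⟨_, rfl⟩
  let e := Fintype.equivFinOfCardEq hm.symm
  rw [← hm] at hcard
  clear_value e
  clear hm
  have hzP : ∀ i, z i ∈ P := fun i => hz (mem_range_self i)
  rw [← e.symm.sum_comp] at hsum hcomb
  have hinj : ∀ i j, i ≠ j → z (e.symm i) ≠ z (e.symm j) := by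
    intro i j hij h
    exact hij (e.symm.injective (hind.injective h))
  interval_cases m
  · simp at hsum
  · simp only [Fin.sum_univ_one] at hsum hcomb
    rw [hsum, one_smul] at hcomb
    obtain ⟨b, hb, hne⟩ := hP2.exists_ne q
    exact absurd (by unfold orient; ring) (hgen b hb q (hcomb ▸ hzP _) hne)
  · simp only [Fin.sum_univ_two] at hsum hcomb
    refine absurd ?_ (hgen _ (hzP _) _ (hzP _) (hinj 0 1 (by simp)))
    rw [← hcomb]
    obtain h1 : w (e.symm 1) = 1 - w (e.symm 0) := by linarith
    rw [h1]
    simp only [orient, PiLp.add_apply, PiLp.smul_apply, smul_eq_mul]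
    ring
  · simp only [Fin.sum_univ_three] at hsum hcomb
    set a := z (e.symm 0)
    set b := z (e.symm 1)
    set c := z (e.symm 2)
    set α := w (e.symm 0) with hα
    set β := w (e.symm 1) with hβ
    set γ := w (e.symm 2) with hγ
    have pα : 0 < α := hw _
    have pβ : 0 < β := hw _
    have pγ : 0 < γ := hw _
    obtain rfl : q = α • a + β • b + γ • c := hcomb.symm
    have e1 : orient (α • a + β • b + γ • c) b c = α * orient a b c := by
      have : γ = 1 - α - β := by linarith
      rw [this]
      simp only [orient, PiLp.add_apply, PiLp.smul_apply, smul_eq_mul]; ring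
    have e2 : orient a (α • a + β • b + γ • c) c = β * orient a b c := by
      have : γ = 1 - α - β := by linarith
      rw [this]
      simp only [orient, PiLp.add_apply, PiLp.smul_apply, smul_eq_mul]; ring
    have e3 : orient a b (α • a + β • b + γ • c) = γ * orient a b c := by
      have : α = 1 - γ - β := by linarith
      rw [this]
      simp only [orient, PiLp.add_apply, PiLp.smul_apply, smul_eq_mul]; ring
    have hne : orient a b c ≠ 0 := by
      intro h0
      refine hgen a (hzP _) b (hzP _) (hinj 0 1 (by simp)) ?_
      rw [e3, h0, mul_zero]
    rcases hne.lt_or_gt with h | h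
    · have h' : 0 < orient a c b := by rw [orient_swap]; linarith
      refine ⟨a, hzP _, c, hzP _, b, hzP _, h', ?_, ?_, ?_⟩
      · rw [orient_swap, e1, ← mul_neg, ← orient_swap]; positivity
      · rw [orient_swap, e3, ← mul_neg, ← orient_swap]; positivity
      · rw [orient_swap, e2, ← mul_neg, ← orient_swap]; positivity
    · exact ⟨a, hzP _, b, hzP _, c, hzP _, h, by rw [e1]; positivity, by rw [e2]; positivity,
        by rw [e3]; positivity⟩

lemma exists_delaunayTri_of_generic {P : Set Pt} (hfin : P.Finite) (hP2 : P.Nontrivial) {q : Pt}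
    (hq : q ∈ convexHull ℝ P) (hgen : ∀ a ∈ P, ∀ b ∈ P, a ≠ b → orient a b q ≠ 0) :
    ∃ t ∈ delaunayTris P, q ∈ triSet t := by
  let A : Set (Pt × Pt × Pt) := {x | x ∈ P ×ˢ P ×ˢ P ∧ Encloses q x.1 x.2.1 x.2.2}
  have hA : A.Finite := (hfin.prod (hfin.prod hfin)).subset fun x hx => hx.1
  have hA0 : A.Nonempty := by
    obtain ⟨a, ha, b, hb, c, hc, h⟩ := exists_encloses hP2 hq hgen
    exact ⟨(a, b, c), ⟨ha, hb, hc⟩, h⟩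
  obtain ⟨⟨a, b, c⟩, ⟨⟨ha, hb, hc⟩, henc⟩, hmin⟩ :=
    exists_min_image A (fun x => liftHeight q x.1 x.2.1 x.2.2) hA hA0
  simp only at ha hb hc henc hmin
  have hmin' : ∀ x ∈ P, ∀ y ∈ P, ∀ z ∈ P, Encloses q x y z →
      liftHeight q a b c ≤ liftHeight q x y z :=
    fun x hx y hy z hz h => hmin (x, y, z) ⟨⟨hx, hy, hz⟩, h⟩
  obtain ⟨h1, h2, h3, h4⟩ := henc
  refine ⟨{a, b, c}, ⟨card_triple h1.ne', triple_subset ha hb hc, ?_⟩, ?_⟩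
  · rw [orderKTri_zero_iff h1]
    intro p hp
    by_contra hneg
    push Not at hneg
    have hself : ∀ x y : Pt, orient x x y = 0 ∧ orient x y y = 0 ∧ orient x y x = 0 := by
      intro x y; unfold orient; refine ⟨?_, ?_, ?_⟩ <;> ring
    have hza : inCirc a b c a = 0 ∧ inCirc a b c b = 0 ∧ inCirc a b c c = 0 := by
      refine ⟨?_, ?_, ?_⟩ <;> simp only [inCirc, orient] <;> ring
    have hpa : p ≠ a := by rintro rfl; linarith
    have hpb : p ≠ b := by rintro rfl; linarith
    have hpc : p ≠ c := by rintro rfl; linarith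
    have henc : Encloses q a b c := ⟨h1, h2, h3, h4⟩
    have hs := orient_sum a b c p
    rcases exists_max_ratio h2 h3 h4 (by rw [hs]; exact h1) with h | h | h
    · obtain ⟨hE, hl⟩ := exists_lower henc hneg h.1 h.2.1 h.2.2 (hgen p hp c hc hpc)
        (hgen p hp b hb hpb)
      exact absurd hl (not_lt.2 (hmin' _ hp _ hb _ hc hE))
    · have r1 : orient q c a = orient a q c := orient_rotate a q c
      have r2 : orient b p a = orient a b p := by rw [← orient_rotate, ← orient_rotate]
      have r3 : orient b q a = orient a b q := by rw [orient_rotate]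
      have r4 : orient p c a = orient a p c := orient_rotate a p c
      have r5 : orient b c q = orient q b c := orient_rotate q b c
      have r6 : orient b c p = orient p b c := orient_rotate p b c
      obtain ⟨hE, hl⟩ := exists_lower henc.rotate (by rwa [inCirc_rotate]) (by rw [r4]; exact h.1)
        (by rw [r1, r2, r3, r4]; exact h.2.1) (by rw [r1, r6, r5, r4]; exact h.2.2)
        (hgen p hp a ha hpa) (hgen p hp c hc hpc)
      rw [liftHeight_rotate q a b c] at hl
      exact absurd hl (not_lt.2 (hmin' _ hp _ hc _ ha hE))
    · have r1 : orient q a b = orient a b q := by rw [← orient_rotate]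
      have r2 : orient c p b = orient p b c := by rw [← orient_rotate]
      have r3 : orient c q b = orient q b c := by rw [← orient_rotate]
      have r4 : orient p a b = orient a b p := by rw [← orient_rotate]
      have r5 : orient c a q = orient a q c := by rw [orient_rotate, orient_rotate]
      have r6 : orient c a p = orient a p c := by rw [orient_rotate, orient_rotate]
      obtain ⟨hE, hl⟩ := exists_lower henc.rotate.rotate (by rwa [inCirc_rotate, inCirc_rotate])
        (by rw [r4]; exact h.1)
        (by rw [r1, r2, r3, r4]; exact h.2.1) (by rw [r1, r6, r5, r4]; exact h.2.2)
        (hgen p hp b hb hpb) (hgen p hp a ha hpa)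
      rw [liftHeight_rotate q b c a, liftHeight_rotate q a b c] at hl
      exact absurd hl (not_lt.2 (hmin' _ hp _ ha _ hb hE))
  · exact (mem_triSet_of_pos h1).2 ⟨h2.le, h3.le, h4.le⟩

lemma delaunayTris_finite {P : Set Pt} (hfin : P.Finite) : (delaunayTris P).Finite := by
  refine (hfin.toFinset.powerset.finite_toSet).subset ?_
  rintro t ⟨-, ht, -⟩
  simp only [Finset.mem_coe, Finset.mem_powerset]
  intro x hx
  exact hfin.mem_toFinset.2 (ht hx)

lemma dense_orient_ne {a b : Pt} (hab : a ≠ b) : Dense {q : Pt | orient a b q ≠ 0} := by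
  rw [dense_iff_inter_open]
  rintro U hU ⟨q, hq⟩
  by_cases h : orient a b q = 0
  · obtain ⟨s, hs, hm⟩ := exists_pos_add_smul_mem hU hq !₂[-(b 1 - a 1), b 0 - a 0]
    refine ⟨_, hm, ?_⟩
    have e : orient a b (q + s • !₂[-(b 1 - a 1), b 0 - a 0]) =
        orient a b q + s * dist b a ^ 2 := by
      rw [dist_sq_eq]
      simp only [orient, PiLp.add_apply, PiLp.smul_apply, smul_eq_mul, Matrix.cons_val_zero,
        Matrix.cons_val_one, Matrix.cons_val_fin_one]
      ring
    have := dist_pos.2 hab.symm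
    simp only [mem_ofPred_eq, e, h, zero_add]
    positivity
  · exact ⟨q, hq, h⟩

/-- The empty-circumdisk triangles cover the convex hull. -/
lemma exists_delaunayTri {P : Set Pt} (hP : Generic P) {a b c : Pt} (ha : a ∈ P) (hb : b ∈ P)
    (hc : c ∈ P) (h : orient a b c ≠ 0) {q : Pt} (hq : q ∈ convexHull ℝ P) :
    ∃ t ∈ delaunayTris P, q ∈ triSet t := by
  have hab := (ne_of_orient_ne_zero h).1
  let U : Set Pt := ⋂ x ∈ {x : Pt × Pt | x ∈ P ×ˢ P ∧ x.1 ≠ x.2}, {q | orient x.1 x.2 q ≠ 0}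
  have hUd : Dense U := by
    apply dense_biInter_of_isOpen
    · intro x _
      exact isOpen_ne_fun (continuous_orient continuous_const continuous_const continuous_id)
        continuous_const
    · exact ((hP.finite.prod hP.finite).subset fun x hx => hx.1).countable
    · intro x hx
      exact dense_orient_ne hx.2
  have hint : (interior (convexHull ℝ P)).Nonempty := by
    have hsub : triSet {a, b, c} ⊆ convexHull ℝ P := triSet_subset (triple_subset ha hb hc)
    refine ⟨(1 / 3 : ℝ) • a + (1 / 3 : ℝ) • b + (1 / 3 : ℝ) • c, interior_mono hsub ?_⟩
    rw [mem_interior_triSet_iff h]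
    have hpos : 0 < orient a b c * orient a b c := mul_self_pos.2 h
    refine ⟨?_, ?_, ?_⟩
    all_goals
      refine lt_of_lt_of_eq (b := 1 / 3 * (orient a b c * orient a b c)) (by positivity) ?_
      simp only [orient, PiLp.add_apply, PiLp.smul_apply, smul_eq_mul]
      ring
  have hclosed : IsClosed (⋃ t ∈ delaunayTris P, triSet t) :=
    (delaunayTris_finite hP.finite).isClosed_biUnion fun t _ =>
      (t.finite_toSet.isCompact_convexHull (𝕜 := ℝ)).isClosed
  have hsub : interior (convexHull ℝ P) ∩ U ⊆ ⋃ t ∈ delaunayTris P, triSet t := by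
    rintro x ⟨hx, hxU⟩
    obtain ⟨t, ht, hxt⟩ := exists_delaunayTri_of_generic hP.finite ⟨a, ha, b, hb, hab⟩
      (interior_subset hx) (fun u hu v hv huv => by
        have := mem_iInter₂.1 hxU (u, v) ⟨⟨hu, hv⟩, huv⟩
        exact this)
    exact mem_iUnion₂.2 ⟨t, ht, hxt⟩
  have hmem : q ∈ ⋃ t ∈ delaunayTris P, triSet t := by
    have h1 : q ∈ closure (interior (convexHull ℝ P)) := by
      rw [(convex_convexHull ℝ P).closure_interior_eq_closure_of_nonempty_interior hint]
      exact subset_closure hq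
    have h2 := closure_minimal (hUd.open_subset_closure_inter isOpen_interior) isClosed_closure h1
    exact closure_minimal hsub hclosed h2
  simpa using hmem

/-! ### Flipping quadrilaterals -/

lemma exists_orient_ne {V : Set Pt} (hV : IsOpen V) (hne : V.Nonempty) {a c : Pt} (h : a ≠ c) :
    ∃ q ∈ V, orient a c q ≠ 0 := by
  obtain ⟨q, hq, hq'⟩ := (dense_orient_ne h).inter_open_nonempty V hV hne
  exact ⟨q, hq, hq'⟩

section Quad

variable {a b c d : Pt}

/-- In a convex quadrilateral `a b c d`, the triangle `a b d` is covered by `a b c`, `a c d`. -/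
lemma triSet_subset_union (h1 : 0 < orient a b c) (h2 : 0 < orient a c d)
    (h3 : 0 < orient a b d) (h4 : 0 < orient b c d) :
    triSet {a, b, d} ⊆ triSet {a, b, c} ∪ triSet {a, c, d} := by
  intro q hq
  rw [mem_triSet_of_pos h3] at hq
  obtain ⟨q1, q2, q3⟩ := hq
  rw [mem_union, mem_triSet_of_pos h1, mem_triSet_of_pos h2]
  have e1 : orient a b d * orient q b c =
      orient q b d * orient a b c + orient a b q * orient b c d := by unfold orient; ring
  have e2 : orient a b d * orient q c d =
      orient q b d * orient a c d + orient a q d * orient b c d := by unfold orient; ring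
  have p1 : 0 ≤ orient q b c := nonneg_of_mul_nonneg_right (by rw [e1]; positivity) h3
  have p2 : 0 ≤ orient q c d := nonneg_of_mul_nonneg_right (by rw [e2]; positivity) h3
  rcases le_total 0 (orient a q c) with h | h
  · exact Or.inl ⟨p1, h, q3⟩
  · refine Or.inr ⟨p2, q2, ?_⟩
    rw [orient_swap] at h; linarith

lemma exists_mem_interior_of_subset (h1 : 0 < orient a b c) (h2 : 0 < orient a c d)
    (h3 : 0 < orient a b d) (h4 : 0 < orient b c d) {V : Set Pt} (hV : IsOpen V)
    (hne : V.Nonempty) (hVs : V ⊆ interior (triSet {a, b, d})) :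
    (V ∩ interior (triSet {a, b, c})).Nonempty ∨ (V ∩ interior (triSet {a, c, d})).Nonempty := by
  obtain ⟨q, hq, hqne⟩ := exists_orient_ne hV hne (ne_of_orient_ne_zero h1.ne').2.1
  have hqs := hVs hq
  rw [mem_interior_triSet_of_pos h3] at hqs
  obtain ⟨q1, q2, q3⟩ := hqs
  have e1 : orient a b d * orient q b c =
      orient q b d * orient a b c + orient a b q * orient b c d := by unfold orient; ring
  have e2 : orient a b d * orient q c d =
      orient q b d * orient a c d + orient a q d * orient b c d := by unfold orient; ring
  have p1 : 0 < orient q b c := pos_of_mul_pos_right (by rw [e1]; positivity) h3.le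
  have p2 : 0 < orient q c d := pos_of_mul_pos_right (by rw [e2]; positivity) h3.le
  rcases hqne.lt_or_gt with h | h
  · refine Or.inl ⟨q, hq, (mem_interior_triSet_of_pos h1).2 ⟨p1, ?_, q3⟩⟩
    rw [orient_swap]; linarith
  · exact Or.inr ⟨q, hq, (mem_interior_triSet_of_pos h2).2 ⟨p2, q2, h⟩⟩

end Quad

/-- A convex quadrilateral `a b c d` of `P` whose Delaunay diagonal is `a c`, and whose flip to
the diagonal `b d` yields triangles of order at most `k`, the triangle `a b d` having order
exactly `k`. -/
structure FlipQuad (P : Set Pt) (k : ℕ) (a b c d : Pt) : Prop where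
  mem_a : a ∈ P
  mem_b : b ∈ P
  mem_c : c ∈ P
  mem_d : d ∈ P
  abc : 0 < orient a b c
  acd : 0 < orient a c d
  abd : 0 < orient a b d
  bcd : 0 < orient b c d
  del_abc : OrderKTri P 0 {a, b, c}
  del_acd : OrderKTri P 0 {a, c, d}
  order_abd : OrderKTri P k {a, b, d}
  order_bcd : OrderKTri P k {b, c, d}
  exact_abd : ¬ OrderKTri P (k - 1) {a, b, d}

namespace FlipQuad

variable {P : Set Pt} {k : ℕ} {a b c d : Pt}

lemma mem_del_abc (h : FlipQuad P k a b c d) : {a, b, c} ∈ delaunayTris P :=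
  ⟨card_triple h.abc.ne', triple_subset h.mem_a h.mem_b h.mem_c, h.del_abc⟩

lemma mem_del_acd (h : FlipQuad P k a b c d) : {a, c, d} ∈ delaunayTris P :=
  ⟨card_triple h.acd.ne', triple_subset h.mem_a h.mem_c h.mem_d, h.del_acd⟩

/-- An open subset of a flipped triangle meets one of the removed triangles. -/
lemma inter_nonempty (h : FlipQuad P k a b c d) {t : Finset Pt}
    (ht : t = {a, b, d} ∨ t = {b, c, d}) {V : Set Pt} (hV : IsOpen V) (hne : V.Nonempty)
    (hVs : V ⊆ interior (triSet t)) :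
    ∃ s : Finset Pt, (s = {a, b, c} ∨ s = {a, c, d}) ∧ (V ∩ interior (triSet s)).Nonempty := by
  rcases ht with rfl | rfl
  · rcases exists_mem_interior_of_subset h.abc h.acd h.abd h.bcd hV hne hVs with h' | h'
    · exact ⟨_, Or.inl rfl, h'⟩
    · exact ⟨_, Or.inr rfl, h'⟩
  · have e1 : ({c, d, b} : Finset Pt) = {b, c, d} := by ext x; simp; tauto
    have e2 : ({c, d, a} : Finset Pt) = {a, c, d} := by ext x; simp; tauto
    have e3 : ({c, a, b} : Finset Pt) = {a, b, c} := by ext x; simp; tauto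
    have hVs' : V ⊆ interior (triSet {c, d, b}) := by rwa [e1]
    rcases exists_mem_interior_of_subset (a := c) (b := d) (c := a) (d := b)
      (by rw [orient_rotate]; exact h.acd) (by rw [← orient_rotate]; exact h.abc)
      (by rw [orient_rotate]; exact h.bcd) (by rw [← orient_rotate]; exact h.abd) hV hne hVs'
      with h' | h'
    · exact ⟨_, Or.inr e2, h'⟩
    · exact ⟨_, Or.inl e3, h'⟩

lemma subset_union (h : FlipQuad P k a b c d) {t : Finset Pt}
    (ht : t = {a, b, c} ∨ t = {a, c, d}) :
    triSet t ⊆ triSet {a, b, d} ∪ triSet {b, c, d} := by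
  have e1 : ({b, c, a} : Finset Pt) = {a, b, c} := by ext x; simp; tauto
  have e2 : ({b, d, a} : Finset Pt) = {a, b, d} := by ext x; simp; tauto
  have e3 : ({d, a, c} : Finset Pt) = {a, c, d} := by ext x; simp; tauto
  have e4 : ({d, a, b} : Finset Pt) = {a, b, d} := by ext x; simp; tauto
  have e5 : ({d, b, c} : Finset Pt) = {b, c, d} := by ext x; simp; tauto
  rcases ht with rfl | rfl
  · have := triSet_subset_union (a := b) (b := c) (c := d) (d := a) h.bcd
      (by rw [orient_rotate]; exact h.abd) (by rw [orient_rotate]; exact h.abc)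
      (by rw [orient_rotate]; exact h.acd)
    rw [e1, e2, union_comm] at this
    exact this
  · have := triSet_subset_union (a := d) (b := a) (c := b) (d := c)
      (by rw [← orient_rotate]; exact h.abd) (by rw [← orient_rotate]; exact h.bcd)
      (by rw [← orient_rotate]; exact h.acd) h.abc
    rw [e3, e4, e5] at this
    exact this

lemma disjoint_flipped (h : FlipQuad P k a b c d) :
    interior (triSet {a, b, d}) ∩ interior (triSet {b, c, d}) = ∅ := by
  rw [eq_empty_iff_forall_notMem]
  rintro q ⟨h1, h2⟩
  rw [mem_interior_triSet_of_pos h.abd] at h1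
  rw [mem_interior_triSet_of_pos h.bcd] at h2
  have e : orient b q d = -orient q b d := by unfold orient; ring
  linarith [h1.1, h2.2.1]

end FlipQuad

section Family

variable {ι : Type*} {P : Set Pt} {k : ℕ} {a b c d : ι → Pt}

/-- The Delaunay triangles of `P`, with the quadrilaterals indexed by `S` flipped. -/
def flipTris (P : Set Pt) (a b c d : ι → Pt) (S : Finset ι) : Set (Finset Pt) :=
  {t | t ∈ delaunayTris P ∧ ∀ i ∈ S, ¬ (t = {a i, b i, c i} ∨ t = {a i, c i, d i})} ∪
  {t | ∃ i ∈ S, t = {a i, b i, d i} ∨ t = {b i, c i, d i}}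

/-- The quadrilaterals of the family have pairwise disjoint vertex sets. -/
def VertexDisjoint (a b c d : ι → Pt) : Prop :=
  ∀ i j, i ≠ j → ∀ x ∈ ({a i, b i, c i, d i} : Finset Pt),
    x ∉ ({a j, b j, c j, d j} : Finset Pt)

lemma isTriangulation_flipTris (hP : Generic P) (hflip : ∀ i, FlipQuad P k (a i) (b i) (c i) (d i))
    (hdis : VertexDisjoint a b c d) {u v w : Pt} (hu : u ∈ P) (hv : v ∈ P) (hw : w ∈ P)
    (huvw : orient u v w ≠ 0) (S : Finset ι) : IsTriangulation P (flipTris P a b c d S) := by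
  classical
  have hsub : ∀ t ∈ flipTris P a b c d S, t.card = 3 ∧ (t : Set Pt) ⊆ P := by
    rintro t (⟨ht, -⟩ | ⟨i, -, rfl | rfl⟩)
    · exact ⟨ht.1, ht.2.1⟩
    · exact ⟨card_triple (hflip i).abd.ne',
        triple_subset (hflip i).mem_a (hflip i).mem_b (hflip i).mem_d⟩
    · exact ⟨card_triple (hflip i).bcd.ne',
        triple_subset (hflip i).mem_b (hflip i).mem_c (hflip i).mem_d⟩
  have hcover : ∀ q ∈ convexHull ℝ P, ∃ t ∈ flipTris P a b c d S, q ∈ triSet t := by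
    intro q hq
    obtain ⟨t, ht, hqt⟩ := exists_delaunayTri hP hu hv hw huvw hq
    by_cases h : ∀ i ∈ S, ¬ (t = {a i, b i, c i} ∨ t = {a i, c i, d i})
    · exact ⟨t, Or.inl ⟨ht, h⟩, hqt⟩
    · push Not at h
      obtain ⟨i, hi, h⟩ := h
      rcases (hflip i).subset_union h hqt with h' | h'
      · exact ⟨_, Or.inr ⟨i, hi, Or.inl rfl⟩, h'⟩
      · exact ⟨_, Or.inr ⟨i, hi, Or.inr rfl⟩, h'⟩
  have hdel : ∀ i, ∀ s : Finset Pt, (s = {a i, b i, c i} ∨ s = {a i, c i, d i}) →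
      s ∈ delaunayTris P := by
    rintro i s (rfl | rfl)
    · exact (hflip i).mem_del_abc
    · exact (hflip i).mem_del_acd
  -- a flipped triangle is disjoint from every kept triangle
  have hmixed : ∀ t s : Finset Pt, t ∈ delaunayTris P →
      (∀ i ∈ S, ¬ (t = {a i, b i, c i} ∨ t = {a i, c i, d i})) →
      (∃ i ∈ S, s = {a i, b i, d i} ∨ s = {b i, c i, d i}) →
      interior (triSet t) ∩ interior (triSet s) = ∅ := by
    rintro t s ht hkeep ⟨i, hi, hs⟩
    by_contra hne
    obtain ⟨o, ho, x, hx, hxo⟩ := (hflip i).inter_nonempty hs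
      (isOpen_interior.inter isOpen_interior) (nonempty_iff_ne_empty.2 hne) inter_subset_right
    have := delaunayTris_disjoint hP ht (hdel i o ho) (fun h => hkeep i hi (h ▸ ho))
    exact (eq_empty_iff_forall_notMem.1 this) x ⟨hx.1, hxo⟩
  refine ⟨?_, hsub, ?_, ?_, ?_⟩
  · refine (hP.finite.toFinset.powerset.finite_toSet).subset fun t ht => ?_
    simp only [Finset.mem_coe, Finset.mem_powerset]
    exact fun x hx => hP.finite.mem_toFinset.2 ((hsub t ht).2 hx)
  · intro p hp
    obtain ⟨t, ht, hpt⟩ := exists_delaunayTri hP hu hv hw huvw (subset_convexHull ℝ P hp)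
    have hmem := mem_of_mem_delaunayTri hP ht hp hpt
    by_cases h : ∀ i ∈ S, ¬ (t = {a i, b i, c i} ∨ t = {a i, c i, d i})
    · exact ⟨t, Or.inl ⟨ht, h⟩, hmem⟩
    · push Not at h
      obtain ⟨i, hi, h⟩ := h
      have hp4 : p ∈ ({a i, b i, d i} : Finset Pt) ∨ p ∈ ({b i, c i, d i} : Finset Pt) := by
        rcases h with rfl | rfl <;>
          simp only [Finset.mem_insert, Finset.mem_singleton] at hmem ⊢ <;> tauto
      rcases hp4 with h' | h'
      · exact ⟨_, Or.inr ⟨i, hi, Or.inl rfl⟩, h'⟩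
      · exact ⟨_, Or.inr ⟨i, hi, Or.inr rfl⟩, h'⟩
  · rintro t (⟨ht, htk⟩ | ht) s (⟨hs, hsk⟩ | hs) hts
    · exact delaunayTris_disjoint hP ht hs hts
    · exact hmixed t s ht htk hs
    · rw [inter_comm]
      exact hmixed s t hs hsk ht
    · obtain ⟨i, hi, ht⟩ := ht
      obtain ⟨j, hj, hs⟩ := hs
      by_cases hij : i = j
      · subst hij
        rcases ht with rfl | rfl <;> rcases hs with rfl | rfl
        · exact absurd rfl hts
        · exact (hflip i).disjoint_flipped
        · rw [inter_comm]
          exact (hflip i).disjoint_flipped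
        · exact absurd rfl hts
      · by_contra hne
        have hopen : IsOpen (interior (triSet t) ∩ interior (triSet s)) :=
          isOpen_interior.inter isOpen_interior
        obtain ⟨o, ho, hne'⟩ := (hflip i).inter_nonempty ht hopen (nonempty_iff_ne_empty.2 hne)
          inter_subset_left
        obtain ⟨o', ho', x, hx, hxo⟩ := (hflip j).inter_nonempty hs
          (hopen.inter isOpen_interior) hne' (inter_subset_left.trans inter_subset_right)
        have hoo : o ≠ o' := by
          rintro rfl
          have h1 : a i ∈ o := by rcases ho with rfl | rfl <;> simp
          refine hdis i j hij (a i) (by simp) ?_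
          rcases ho' with rfl | rfl <;>
            simp only [Finset.mem_insert, Finset.mem_singleton] at h1 ⊢ <;> tauto
        have := delaunayTris_disjoint hP (hdel i o ho) (hdel j o' ho') hoo
        exact (eq_empty_iff_forall_notMem.1 this) x ⟨hx.2, hxo⟩
  · apply Subset.antisymm
    · exact iUnion₂_subset fun t ht => triSet_subset (hsub t ht).2
    · intro q hq
      obtain ⟨t, ht, h⟩ := hcover q hq
      exact mem_iUnion₂.2 ⟨t, ht, h⟩

lemma mem_iff_notMem_flipTris (hflip : ∀ i, FlipQuad P k (a i) (b i) (c i) (d i))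
    (hdis : VertexDisjoint a b c d) (S : Finset ι) (i : ι) :
    i ∈ S ↔ {a i, b i, c i} ∉ flipTris P a b c d S := by
  constructor
  · rintro hi (⟨-, h⟩ | ⟨j, hj, h⟩)
    · exact h i hi (Or.inl rfl)
    · have hij : i = j := by
        by_contra hij
        have : b i ∈ ({a i, b i, c i} : Finset Pt) := by simp
        refine hdis i j hij (b i) (by simp) ?_
        rcases h with h | h <;> rw [h] at this <;>
          simp only [Finset.mem_insert, Finset.mem_singleton] at this ⊢ <;> tauto
      subst hij
      have n1 := ne_of_orient_ne_zero (hflip i).abc.ne'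
      have n2 := ne_of_orient_ne_zero (hflip i).acd.ne'
      have n3 := ne_of_orient_ne_zero (hflip i).bcd.ne'
      have hd : d i ∉ ({a i, b i, c i} : Finset Pt) := by
        simp only [Finset.mem_insert, Finset.mem_singleton, not_or]
        exact ⟨n2.2.1.symm, n3.2.1.symm, n2.2.2.symm⟩
      rcases h with h | h <;> rw [h] at hd <;> simp at hd
  · intro h
    by_contra hi
    refine h (Or.inl ⟨(hflip i).mem_del_abc, fun j hj hor => ?_⟩)
    have hij : i ≠ j := fun e => hi (e ▸ hj)
    have : b i ∈ ({a i, b i, c i} : Finset Pt) := by simp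
    refine hdis i j hij (b i) (by simp) ?_
    rcases hor with h | h <;> rw [h] at this <;>
      simp only [Finset.mem_insert, Finset.mem_singleton] at this ⊢ <;> tauto

/-- The order-`k` Delaunay triangulations that have no smaller order. -/
def exactOrderDTs (P : Set Pt) (k : ℕ) : Set (Set (Finset Pt)) :=
  {T | IsOrderDT P k T ∧ ∀ i < k, ¬ IsOrderDT P i T}

lemma exactOrderDTs_subset (P : Set Pt) (k : ℕ) : exactOrderDTs P k ⊆
    𝒫 {t : Finset Pt | t.card = 3 ∧ (t : Set Pt) ⊆ P ∧ OrderKTri P k t} :=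
  fun _ hT t ht => ⟨(hT.1.1.2.1 t ht).1, (hT.1.1.2.1 t ht).2, hT.1.2 t ht⟩

lemma finite_triples (hP : P.Finite) (k : ℕ) :
    {t : Finset Pt | t.card = 3 ∧ (t : Set Pt) ⊆ P ∧ OrderKTri P k t}.Finite := by
  refine (hP.toFinset.powerset.finite_toSet).subset ?_
  rintro t ⟨-, ht, -⟩
  simp only [Finset.mem_coe, Finset.mem_powerset]
  exact fun x hx => hP.mem_toFinset.2 (ht hx)

/-- A vertex-disjoint family of `m` flippable quadrilaterals gives `2 ^ m - 1` triangulations of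
order exactly `k`. -/
lemma two_pow_le_ncard_exactOrderDTs [Fintype ι] (hP : Generic P)
    (hflip : ∀ i, FlipQuad P k (a i) (b i) (c i) (d i)) (hdis : VertexDisjoint a b c d) :
    2 ^ Fintype.card ι ≤ (exactOrderDTs P k).ncard + 1 := by
  classical
  have hfin : (exactOrderDTs P k).Finite :=
    ((finite_triples hP.finite k).finite_subsets).subset (exactOrderDTs_subset P k)
  let F : Finset (Finset ι) := Finset.univ.erase ∅
  have hF : 2 ^ Fintype.card ι = F.card + 1 := by
    rw [Finset.card_erase_of_mem (Finset.mem_univ _), Finset.card_univ, Fintype.card_finset]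
    have : 0 < 2 ^ Fintype.card ι := by positivity
    omega
  rw [hF, ← ncard_coe_finset F, add_le_add_iff_right]
  refine ncard_le_ncard_of_injOn (fun S => flipTris P a b c d S) ?_ ?_ hfin
  · intro S hS
    have hS' : S ≠ ∅ := by simpa [F] using hS
    obtain ⟨i, hi⟩ := Finset.nonempty_iff_ne_empty.2 hS'
    refine ⟨⟨isTriangulation_flipTris hP hflip hdis (hflip i).mem_a (hflip i).mem_b (hflip i).mem_c
      (hflip i).abc.ne' S, ?_⟩, ?_⟩
    · rintro t (⟨ht, -⟩ | ⟨j, -, rfl | rfl⟩)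
      · exact ht.2.2.mono (Nat.zero_le k)
      · exact (hflip j).order_abd
      · exact (hflip j).order_bcd
    · intro m hm hT
      refine (hflip i).exact_abd ?_
      exact (hT.2 _ (Or.inr ⟨i, hi, Or.inl rfl⟩)).mono (by omega)
  · intro S _ S' _ h
    ext i
    rw [mem_iff_notMem_flipTris hflip hdis S i, mem_iff_notMem_flipTris hflip hdis S' i]
    simp only at h
    rw [h]

end Family

/-! ### The number of order-`k` triangulations -/

/-- A set-pair inequality of Bollobás type. -/
lemma card_le_two_pow_of_cross {α ι : Type*} [DecidableEq α] (S : Finset α) (L : Finset ι)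
    (D I : ι → Finset α) (m : ℕ) (hD : ∀ b ∈ L, D b ⊆ S) (hI : ∀ b ∈ L, I b ⊆ S)
    (hDI : ∀ b ∈ L, Disjoint (D b) (I b)) (hm : ∀ b ∈ L, (D b).card + (I b).card ≤ m)
    (hcross : ∀ b ∈ L, ∀ b' ∈ L, Disjoint (D b) (I b') → Disjoint (D b') (I b) → b = b') :
    L.card ≤ 2 ^ m := by
  classical
  have hsub : ∀ b ∈ L, D b ⊆ S \ I b := fun b hb =>
    Finset.subset_sdiff.2 ⟨hD b hb, hDI b hb⟩
  have hdisj : (L : Set ι).PairwiseDisjoint fun b => Finset.Icc (D b) (S \ I b) := by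
    intro b hb b' hb' hne
    refine Finset.disjoint_left.2 fun A hA hA' => hne ?_
    rw [Finset.mem_Icc] at hA hA'
    refine hcross b hb b' hb' ?_ ?_
    · exact (Finset.subset_sdiff.1 (hA.1.trans hA'.2)).2
    · exact (Finset.subset_sdiff.1 (hA'.1.trans hA.2)).2
  have hle : ∑ b ∈ L, (Finset.Icc (D b) (S \ I b)).card ≤ 2 ^ S.card := by
    rw [← Finset.card_biUnion hdisj, ← Finset.card_powerset]
    refine Finset.card_le_card fun A hA => ?_
    obtain ⟨b, -, hA⟩ := Finset.mem_biUnion.1 hA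
    exact Finset.mem_powerset.2 ((Finset.mem_Icc.1 hA).2.trans Finset.sdiff_subset)
  have hge : ∀ b ∈ L, 2 ^ S.card ≤ 2 ^ m * (Finset.Icc (D b) (S \ I b)).card := by
    intro b hb
    rw [Finset.card_Icc_finset (hsub b hb), ← pow_add, Finset.card_sdiff_of_subset (hI b hb)]
    have := hm b hb
    exact Nat.pow_le_pow_right (by norm_num) (by omega)
  have h1 : L.card * 2 ^ S.card ≤ 2 ^ m * 2 ^ S.card := by
    calc L.card * 2 ^ S.card = ∑ b ∈ L, 2 ^ S.card := by simp
      _ ≤ ∑ b ∈ L, 2 ^ m * (Finset.Icc (D b) (S \ I b)).card := Finset.sum_le_sum hge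
      _ = 2 ^ m * ∑ b ∈ L, (Finset.Icc (D b) (S \ I b)).card := by rw [Finset.mul_sum]
      _ ≤ 2 ^ m * 2 ^ S.card := Nat.mul_le_mul_left _ hle
  exact Nat.le_of_mul_le_mul_right h1 (by positivity)

lemma inCirc_self (a b c : Pt) :
    inCirc a b c a = 0 ∧ inCirc a b c b = 0 ∧ inCirc a b c c = 0 := by
  refine ⟨?_, ?_, ?_⟩ <;> simp only [inCirc, orient] <;> ring

/-- Two circles through `u` with chords on the same side which do not separate each other's
vertices coincide. -/
lemma Generic.eq_of_no_conflict {P : Set Pt} (hP : Generic P) {u v w v' w' : Pt}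
    (hu : u ∈ P) (hv : v ∈ P) (hw : w ∈ P) (hv' : v' ∈ P) (hw' : w' ∈ P)
    (hvu : v 0 < u 0) (huw : u 0 < w 0) (hvu' : v' 0 < u 0) (huw' : u 0 < w' 0)
    (hsign : 0 < orient u v w * orient u v' w')
    (h1 : 0 ≤ orient u v' w' * inCirc u v' w' v) (h2 : 0 ≤ orient u v' w' * inCirc u v' w' w)
    (h3 : 0 ≤ orient u v w * inCirc u v w v') (h4 : 0 ≤ orient u v w * inCirc u v w w') :
    v = v' ∧ w = w' := by
  set o := orient u v w with ho
  set o' := orient u v' w' with ho'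
  have hone : o ≠ 0 := left_ne_zero_of_mul hsign.ne'
  have hone' : o' ≠ 0 := right_ne_zero_of_mul hsign.ne'
  let f : Pt → ℝ := fun p => o * (o' * (o' * inCirc u v w p - o * inCirc u v' w' p))
  obtain ⟨A, B, hf⟩ : ∃ A B : ℝ, ∀ p, f p = A * (p 0 - u 0) + B * (p 1 - u 1) := by
    obtain ⟨x, y, z, h⟩ := inCirc_expand u v w
    obtain ⟨x', y', z', h'⟩ := inCirc_expand u v' w'
    refine ⟨o * (o' * (o' * x - o * x')), o * (o' * (o' * y - o * y')), fun p => ?_⟩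
    have e1 := h u
    have e2 := h' u
    rw [(inCirc_self u v w).1] at e1
    rw [(inCirc_self u v' w').1] at e2
    simp only [f, h, h', ← ho, ← ho'] at e1 e2 ⊢
    linear_combination (-o * o' * o') * e1 + o * o' * o * e2
  have fv : f v = -((o * o) * (o' * inCirc u v' w' v)) := by
    simp only [f, (inCirc_self u v w).2.1]; ring
  have fw : f w = -((o * o) * (o' * inCirc u v' w' w)) := by
    simp only [f, (inCirc_self u v w).2.2]; ring
  have fv' : f v' = (o' * o') * (o * inCirc u v w v') := by
    simp only [f, (inCirc_self u v' w').2.1]; ring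
  have fw' : f w' = (o' * o') * (o * inCirc u v w w') := by
    simp only [f, (inCirc_self u v' w').2.2]; ring
  have gv : f v ≤ 0 := by rw [fv]; have := mul_nonneg (mul_self_nonneg o) h1; linarith
  have gw : f w ≤ 0 := by rw [fw]; have := mul_nonneg (mul_self_nonneg o) h2; linarith
  have gv' : 0 ≤ f v' := by rw [fv']; exact mul_nonneg (mul_self_nonneg o') h3
  have gw' : 0 ≤ f w' := by rw [fw']; exact mul_nonneg (mul_self_nonneg o') h4
  have e : (w 0 - u 0) * f v + (u 0 - v 0) * f w = -(B * o) := by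
    rw [hf, hf, ho, orient]; ring
  have e' : (w' 0 - u 0) * f v' + (u 0 - v' 0) * f w' = -(B * o') := by
    rw [hf, hf, ho', orient]; ring
  have i1 : 0 ≤ B * o := by
    have := mul_nonneg (sub_nonneg.2 huw.le) (neg_nonneg.2 gv)
    have := mul_nonneg (sub_nonneg.2 hvu.le) (neg_nonneg.2 gw)
    linarith
  have i2 : B * o' ≤ 0 := by
    have := mul_nonneg (sub_nonneg.2 huw'.le) gv'
    have := mul_nonneg (sub_nonneg.2 hvu'.le) gw'
    linarith
  have hB : B = 0 := by
    by_contra hB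
    have h5 : (B * o) * (B * o') ≤ 0 := mul_nonpos_of_nonneg_of_nonpos i1 i2
    have h6 : 0 < (B * B) * (o * o') := mul_pos (mul_self_pos.2 hB) hsign
    linarith
  rw [hB, zero_mul, neg_zero] at e
  have p1 := mul_nonneg (sub_nonneg.2 huw.le) (neg_nonneg.2 gv)
  have p2 := mul_nonneg (sub_nonneg.2 hvu.le) (neg_nonneg.2 gw)
  have zv : f v = 0 :=
    (mul_eq_zero.1 (show (w 0 - u 0) * f v = 0 by linarith)).resolve_left (sub_pos.2 huw).ne'
  have zw : f w = 0 :=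
    (mul_eq_zero.1 (show (u 0 - v 0) * f w = 0 by linarith)).resolve_left (sub_pos.2 hvu).ne'
  have cv : inCirc u v' w' v = 0 := by
    rw [fv, neg_eq_zero] at zv
    simpa [hone, hone'] using zv
  have cw : inCirc u v' w' w = 0 := by
    rw [fw, neg_eq_zero] at zw
    simpa [hone, hone'] using zw
  have mv := hP.inCirc_eq_zero hone' hu hv' hw' hv cv
  have mw := hP.inCirc_eq_zero hone' hu hv' hw' hw cw
  simp only [Finset.mem_insert, Finset.mem_singleton] at mv mw
  constructor
  · rcases mv with rfl | h | rfl
    · exact absurd hvu (lt_irrefl _)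
    · exact h
    · linarith
  · rcases mw with rfl | rfl | h
    · exact absurd huw (lt_irrefl _)
    · linarith
    · exact h

/-- In a generic set with distinct abscissae there are only linearly many order-`k` triangles. -/
lemma Generic.ncard_triples_le {P : Set Pt} (hP : Generic P)
    (hx : InjOn (fun p : Pt => p 0) P) (k : ℕ) :
    {t : Finset Pt | t.card = 3 ∧ (t : Set Pt) ⊆ P ∧ OrderKTri P k t}.ncard ≤
      2 ^ (k + 3) * P.ncard := by
  classical
  set F := hP.finite.toFinset with hF
  have hFP : ∀ p, p ∈ F ↔ p ∈ P := fun p => by simp [hF]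
  let L : Pt × Bool → Finset (Pt × Pt) := fun b => (F ×ˢ F).filter fun q =>
    q.1 0 < b.1 0 ∧ b.1 0 < q.2 0 ∧
      (0 < if b.2 then orient b.1 q.1 q.2 else -orient b.1 q.1 q.2) ∧
      OrderKTri P k {b.1, q.1, q.2}
  have hL : ∀ b ∈ F ×ˢ (Finset.univ : Finset Bool), (L b).card ≤ 2 ^ (k + 2) := by
    rintro ⟨u, s⟩ hus
    have hu : u ∈ P := (hFP u).1 (Finset.mem_product.1 hus).1
    have hmem : ∀ q ∈ L (u, s), q.1 ∈ P ∧ q.2 ∈ P ∧ q.1 0 < u 0 ∧ u 0 < q.2 0 ∧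
        (0 < if s then orient u q.1 q.2 else -orient u q.1 q.2) ∧
        orient u q.1 q.2 ≠ 0 ∧ OrderKTri P k {u, q.1, q.2} := by
      intro q hq
      simp only [L, Finset.mem_filter, Finset.mem_product, hFP] at hq
      refine ⟨hq.1.1, hq.1.2, hq.2.1, hq.2.2.1, hq.2.2.2.1, ?_, hq.2.2.2.2⟩
      intro h0
      have := hq.2.2.2.1
      simp [h0] at this
    refine card_le_two_pow_of_cross F (L (u, s)) (fun q => {q.1, q.2})
      (fun q => F.filter fun p => orient u q.1 q.2 * inCirc u q.1 q.2 p < 0) _ ?_ ?_ ?_ ?_ ?_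
    · intro q hq
      obtain ⟨h1, h2, -⟩ := hmem q hq
      simp [Finset.insert_subset_iff, hFP, h1, h2]
    · exact fun q _ => Finset.filter_subset _ _
    · intro q hq
      simp [(inCirc_self u q.1 q.2).2.1, (inCirc_self u q.1 q.2).2.2]
    · intro q hq
      obtain ⟨-, -, -, -, -, h0, ho⟩ := hmem q hq
      have hk : (F.filter fun p => orient u q.1 q.2 * inCirc u q.1 q.2 p < 0).card ≤ k := by
        rw [orderKTri_iff h0] at ho
        have e : {p ∈ P | orient u q.1 q.2 * inCirc u q.1 q.2 p < 0} =
            ((F.filter fun p => orient u q.1 q.2 * inCirc u q.1 q.2 p < 0 : Finset Pt) :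
              Set Pt) := by
          ext p; simp [hFP]
        rw [e, encard_coe_eq_coe_finsetCard] at ho
        exact_mod_cast ho
      have := Finset.card_le_two (a := q.1) (b := q.2)
      omega
    · intro q hq q' hq' hd hd'
      obtain ⟨hv, hw, hvu, huw, hs, h0, ho⟩ := hmem q hq
      obtain ⟨hv', hw', hvu', huw', hs', h0', ho'⟩ := hmem q' hq'
      have hsign : 0 < orient u q.1 q.2 * orient u q'.1 q'.2 := by
        cases s
        · simp only [Bool.false_eq_true, if_false] at hs hs'
          simpa using mul_pos hs hs'
        · simp only [if_true] at hs hs'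
          exact mul_pos hs hs'
      simp only [Finset.disjoint_insert_left, Finset.disjoint_singleton_left, Finset.mem_filter,
        hFP, hv, hw, hv', hw', true_and, not_lt] at hd hd'
      exact Prod.ext_iff.2 (hP.eq_of_no_conflict hu hv hw hv' hw' hvu huw hvu' huw' hsign
        hd.1 hd.2 hd'.1 hd'.2)
  have hsub : {t : Finset Pt | t.card = 3 ∧ (t : Set Pt) ⊆ P ∧ OrderKTri P k t} ⊆
      (((F ×ˢ (Finset.univ : Finset Bool)).biUnion fun b =>
        (L b).image fun q => ({b.1, q.1, q.2} : Finset Pt) : Finset (Finset Pt)) :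
          Set (Finset Pt)) := by
    rintro t ⟨ht3, htP, hto⟩
    obtain ⟨u, v, w, huP, hvP, hwP, hvu, huw, rfl⟩ : ∃ u v w, u ∈ P ∧ v ∈ P ∧ w ∈ P ∧
        v 0 < u 0 ∧ u 0 < w 0 ∧ t = {u, v, w} := by
      obtain ⟨a, b, c, hab, hac, hbc, rfl⟩ := Finset.card_eq_three.1 ht3
      have ha : a ∈ P := htP (by simp)
      have hb : b ∈ P := htP (by simp)
      have hc : c ∈ P := htP (by simp)
      have nab : a 0 ≠ b 0 := fun h => hab (hx ha hb h)
      have nac : a 0 ≠ c 0 := fun h => hac (hx ha hc h)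
      have nbc : b 0 ≠ c 0 := fun h => hbc (hx hb hc h)
      rcases nab.lt_or_gt with h1 | h1 <;> rcases nac.lt_or_gt with h2 | h2 <;>
        rcases nbc.lt_or_gt with h3 | h3
      · exact ⟨b, a, c, hb, ha, hc, h1, h3, by ext; simp; tauto⟩
      · exact ⟨c, a, b, hc, ha, hb, h2, h3, by ext; simp; tauto⟩
      · linarith
      · exact ⟨a, c, b, ha, hc, hb, h2, h1, by ext; simp; tauto⟩
      · exact ⟨a, b, c, ha, hb, hc, h1, h2, by ext; simp⟩
      · linarith
      · exact ⟨c, b, a, hc, hb, ha, h3, h2, by ext; simp; tauto⟩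
      · exact ⟨b, c, a, hb, hc, ha, h3, h1, by ext; simp; tauto⟩
    have hne : orient u v w ≠ 0 := by
      refine hP.orient_ne u huP v hvP w hwP ?_ ?_ ?_ <;> rintro rfl <;> linarith
    simp only [Finset.coe_biUnion, mem_iUnion, Finset.mem_coe, Finset.mem_image]
    refine ⟨(u, decide (0 < orient u v w)),
      Finset.mem_product.2 ⟨(hFP u).2 huP, Finset.mem_univ _⟩, (v, w), ?_, rfl⟩
    simp only [L, Finset.mem_filter, Finset.mem_product, hFP]
    refine ⟨⟨hvP, hwP⟩, hvu, huw, ?_, hto⟩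
    simp only [decide_eq_true_eq]
    split_ifs with h
    · exact h
    · exact neg_pos.2 (lt_of_le_of_ne (not_lt.1 h) hne)
  calc _ ≤ _ := ncard_le_ncard hsub (Finset.finite_toSet _)
    _ = _ := ncard_coe_finset _
    _ ≤ (F ×ˢ (Finset.univ : Finset Bool)).card * 2 ^ (k + 2) :=
      Finset.card_biUnion_le_card_mul _ _ _ fun b hb => Finset.card_image_le.trans (hL b hb)
    _ = 2 ^ (k + 3) * P.ncard := by
      rw [Finset.card_product, ncard_eq_toFinset_card P hP.finite]
      simp only [Finset.card_univ, Fintype.card_bool, ← hF]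
      ring

lemma Generic.ncard_exactOrderDTs_le {P : Set Pt} (hP : Generic P)
    (hx : InjOn (fun p : Pt => p 0) P) (k : ℕ) :
    (exactOrderDTs P k).ncard ≤ 2 ^ (2 ^ (k + 3) * P.ncard) := by
  have hfin := finite_triples hP.finite k
  calc (exactOrderDTs P k).ncard
      ≤ (𝒫 {t : Finset Pt | t.card = 3 ∧ (t : Set Pt) ⊆ P ∧ OrderKTri P k t}).ncard :=
        ncard_le_ncard (exactOrderDTs_subset P k) hfin.powerset
    _ = 2 ^ {t : Finset Pt | t.card = 3 ∧ (t : Set Pt) ⊆ P ∧ OrderKTri P k t}.ncard :=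
        ncard_powerset _ hfin
    _ ≤ _ := Nat.pow_le_pow_right (by norm_num) (hP.ncard_triples_le hx k)

/-! ### Random configurations are generic -/

section AlmostSure

open MeasureTheory Filter

lemma unitSq_eq_preimage :
    unitSq = (WithLp.ofLp : Pt → Fin 2 → ℝ) ⁻¹' Set.univ.pi fun _ => Icc (0 : ℝ) 1 := by
  ext p
  simp only [unitSq, mem_ofPred_eq, mem_preimage, mem_univ_pi, Fin.forall_fin_two]

lemma volume_unitSq : volume unitSq = 1 := by
  rw [unitSq_eq_preimage, (PiLp.volume_preserving_ofLp (Fin 2)).measure_preimage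
    (MeasurableSet.univ_pi fun _ => measurableSet_Icc).nullMeasurableSet, volume_pi_pi]
  simp

instance : IsProbabilityMeasure unifSq := ⟨by simp [unifSq, volume_unitSq]⟩

instance (n : ℕ) : IsProbabilityMeasure (conf n) := by unfold conf; infer_instance

lemma ae_unifSq_of_ae {p : Pt → Prop} (h : ∀ᵐ x, p x) : ∀ᵐ x ∂unifSq, p x :=
  Measure.absolutelyContinuous_of_le Measure.restrict_le_self h

/-- A property holding for almost every position of the `i`-th point, whatever the other points,
holds almost surely. -/
lemma ae_conf_of_forall_update {n : ℕ} {p : (Fin n → Pt) → Prop} (hp : MeasurableSet {x | p x})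
    (i : Fin n) (h : ∀ x, ∀ᵐ y : Pt, p (Function.update x i y)) : ∀ᵐ x ∂conf n, p x := by
  have hm : MeasurableSet {x | ¬ p x} := hp.compl
  have hf : Measurable ({x | ¬ p x}.indicator (1 : (Fin n → Pt) → ENNReal)) :=
    measurable_one.indicator hm
  rw [ae_iff, ← lintegral_indicator_one hm, conf,
    lintegral_eq_lmarginal_univ (fun _ => (0 : Pt)), lmarginal_erase' _ hf (Finset.mem_univ i)]
  have hz : ∀ x : Fin n → Pt, ∫⁻ y, {x | ¬ p x}.indicator (1 : (Fin n → Pt) → ENNReal)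
      (Function.update x i y) ∂unifSq = 0 := by
    intro x
    refine (lintegral_congr_ae (g := fun _ => 0) ?_).trans lintegral_zero
    filter_upwards [ae_unifSq_of_ae (h x)] with y hy
    simp [hy]
  simp only [hz]
  simp [lmarginal]

lemma ae_ne_line {u v : ℝ} (h : u ≠ 0 ∨ v ≠ 0) (w : ℝ) : ∀ᵐ p : Pt, u * p 0 + v * p 1 ≠ w := by
  let s : AffineSubspace ℝ Pt :=
    { carrier := {p | u * p 0 + v * p 1 = w}
      smul_vsub_vadd_mem' := by
        intro c p q r hp hq hr
        simp only [mem_ofPred_eq, vsub_eq_sub, vadd_eq_add, PiLp.add_apply, PiLp.smul_apply,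
          PiLp.sub_apply, smul_eq_mul] at hp hq hr ⊢
        linear_combination c * hp - c * hq + hr }
  have hs : s ≠ ⊤ := by
    intro htop
    have hmem : ∀ p : Pt, u * p 0 + v * p 1 = w := by
      intro p
      have : p ∈ s := by rw [htop]; trivial
      exact this
    have h0 := hmem 0
    have h1 := hmem !₂[u, v]
    simp at h0 h1
    rw [← h0] at h1
    rcases h with h | h <;> nlinarith [mul_self_pos.2 h, mul_self_nonneg u, mul_self_nonneg v]
  have := Measure.addHaar_affineSubspace (volume : Measure Pt) s hs
  rw [ae_iff]
  simp only [ne_eq, not_not]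
  exact this

lemma ae_inCirc_ne {a b c : Pt} (h : orient a b c ≠ 0) : ∀ᵐ p : Pt, inCirc a b c p ≠ 0 := by
  obtain ⟨z, r, ha, hb, hc⟩ := exists_circumcenter h
  have := Measure.addHaar_sphere (volume : Measure Pt) z r
  rw [ae_iff]
  refine measure_mono_null (fun p hp => ?_) this
  simp only [mem_ofPred_eq, not_not] at hp
  rw [inCirc_eq_orient_mul ha hb hc] at hp
  have h0 := (mul_eq_zero.1 hp).resolve_left h
  have hr : 0 ≤ r := ha ▸ dist_nonneg
  exact (sq_eq_sq₀ dist_nonneg hr).1 (by linarith)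

lemma ae_fst_ne (n : ℕ) : ∀ᵐ x ∂conf n, ∀ i j, i ≠ j → x i 0 ≠ x j 0 := by
  simp only [eventually_all]
  intro i j hij
  refine ae_conf_of_forall_update ?_ i fun x => ?_
  · exact (isOpen_ne_fun (by fun_prop) (by fun_prop)).measurableSet
  · filter_upwards [ae_ne_line (u := 1) (v := 0) (Or.inl one_ne_zero) (x j 0)] with p hp
    simpa [Function.update_of_ne hij.symm] using hp

lemma ae_orient_ne (n : ℕ) :
    ∀ᵐ x ∂conf n, ∀ i j l, i ≠ j → i ≠ l → j ≠ l → orient (x i) (x j) (x l) ≠ 0 := by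
  have key : ∀ᵐ x ∂conf n, ∀ i j l, i ≠ j → i ≠ l → j ≠ l →
      (x i 0 ≠ x j 0 → orient (x i) (x j) (x l) ≠ 0) := by
    simp only [eventually_all]
    intro i j l hij hil hjl
    refine ae_conf_of_forall_update ?_ l fun x => ?_
    · have h1 : IsOpen {x : Fin n → Pt | x i 0 ≠ x j 0} :=
        isOpen_ne_fun (by fun_prop) (by fun_prop)
      have h2 : IsOpen {x : Fin n → Pt | orient (x i) (x j) (x l) ≠ 0} :=
        isOpen_ne_fun (continuous_orient (by fun_prop) (by fun_prop) (by fun_prop))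
          continuous_const
      exact h1.measurableSet.imp h2.measurableSet
    · by_cases h : x i 0 = x j 0
      · simp [Function.update_of_ne hil, Function.update_of_ne hjl, h]
      filter_upwards [ae_ne_line (u := -(x j 1 - x i 1)) (v := x j 0 - x i 0)
        (Or.inr (sub_ne_zero.2 (Ne.symm h)))
        ((x j 0 - x i 0) * x i 1 - (x j 1 - x i 1) * x i 0)] with p hp _
      simp only [Function.update_of_ne hil, Function.update_of_ne hjl, Function.update_self]
      intro h0
      apply hp
      unfold orient at h0
      linear_combination h0
  filter_upwards [key, ae_fst_ne n] with x hx hx' i j l hij hil hjl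
  exact hx i j l hij hil hjl (hx' i j hij)

lemma ae_inCirc_conf_ne (n : ℕ) :
    ∀ᵐ x ∂conf n, ∀ i j l m, i ≠ j → i ≠ l → i ≠ m → j ≠ l → j ≠ m → l ≠ m →
      inCirc (x i) (x j) (x l) (x m) ≠ 0 := by
  have key : ∀ᵐ x ∂conf n, ∀ i j l m, i ≠ j → i ≠ l → i ≠ m → j ≠ l → j ≠ m → l ≠ m →
      (orient (x i) (x j) (x l) ≠ 0 → inCirc (x i) (x j) (x l) (x m) ≠ 0) := by
    simp only [eventually_all]
    intro i j l m hij hil him hjl hjm hlm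
    refine ae_conf_of_forall_update ?_ m fun x => ?_
    · have h1 : IsOpen {x : Fin n → Pt | orient (x i) (x j) (x l) ≠ 0} :=
        isOpen_ne_fun (continuous_orient (by fun_prop) (by fun_prop) (by fun_prop))
          continuous_const
      have h2 : IsOpen {x : Fin n → Pt | inCirc (x i) (x j) (x l) (x m) ≠ 0} :=
        isOpen_ne_fun (continuous_inCirc (by fun_prop) (by fun_prop) (by fun_prop) (by fun_prop))
          continuous_const
      exact h1.measurableSet.imp h2.measurableSet
    · simp only [Function.update_of_ne him, Function.update_of_ne hjm, Function.update_of_ne hlm,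
        Function.update_self]
      by_cases h : orient (x i) (x j) (x l) = 0
      · simp [h]
      filter_upwards [ae_inCirc_ne h] with p hp _ using hp
  filter_upwards [key, ae_orient_ne n] with x hx hx' i j l m hij hil him hjl hjm hlm
  exact hx i j l m hij hil him hjl hjm hlm (hx' i j l hij hil hjl)

/-- Configurations of points with distinct abscissae and in general position. -/
def genericConf (n : ℕ) : Set (Fin n → Pt) :=
  {x | (∀ i j, i ≠ j → x i 0 ≠ x j 0) ∧
    (∀ i j l, i ≠ j → i ≠ l → j ≠ l → orient (x i) (x j) (x l) ≠ 0) ∧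
    ∀ i j l m, i ≠ j → i ≠ l → i ≠ m → j ≠ l → j ≠ m → l ≠ m →
      inCirc (x i) (x j) (x l) (x m) ≠ 0}

lemma ae_mem_genericConf (n : ℕ) : ∀ᵐ x ∂conf n, x ∈ genericConf n := by
  filter_upwards [ae_fst_ne n, ae_orient_ne n, ae_inCirc_conf_ne n] with x h1 h2 h3
  exact ⟨h1, h2, h3⟩

variable {n : ℕ} {x : Fin n → Pt}

lemma injective_of_mem_genericConf (hx : x ∈ genericConf n) : Function.Injective x := by
  intro i j hij
  by_contra hne
  exact hx.1 i j hne (by rw [hij])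

lemma injOn_of_mem_genericConf (hx : x ∈ genericConf n) :
    InjOn (fun p : Pt => p 0) (range x) := by
  rintro _ ⟨i, rfl⟩ _ ⟨j, rfl⟩ h
  by_contra hne
  exact hx.1 i j (fun hij => hne (by rw [hij])) h

lemma generic_of_mem_genericConf (hx : x ∈ genericConf n) : Generic (range x) where
  finite := finite_range x
  orient_ne := by
    rintro _ ⟨i, rfl⟩ _ ⟨j, rfl⟩ _ ⟨l, rfl⟩ h1 h2 h3
    exact hx.2.1 i j l (ne_of_apply_ne x h1) (ne_of_apply_ne x h2) (ne_of_apply_ne x h3)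
  inCirc_ne := by
    rintro _ ⟨i, rfl⟩ _ ⟨j, rfl⟩ _ ⟨l, rfl⟩ _ ⟨m, rfl⟩ h1 h2 h3 h4 h5 h6
    exact hx.2.2 i j l m (ne_of_apply_ne x h1) (ne_of_apply_ne x h2) (ne_of_apply_ne x h3)
      (ne_of_apply_ne x h4) (ne_of_apply_ne x h5) (ne_of_apply_ne x h6)

lemma ncard_exactOrderDTs_range_le (hx : x ∈ genericConf n) (k : ℕ) :
    (exactOrderDTs (range x) k).ncard ≤ 2 ^ (2 ^ (k + 3) * n) := by
  have := (generic_of_mem_genericConf hx).ncard_exactOrderDTs_le (injOn_of_mem_genericConf hx) k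
  rwa [← image_univ, ncard_image_of_injective _ (injective_of_mem_genericConf hx), image_univ,
    ncard_univ, Nat.card_fin] at this

end AlmostSure

/-! ### Measurability of the number of triangulations -/

section Measurability

open MeasureTheory Filter

lemma mem_convexHull_range_iff {ι : Type*} [Fintype ι] {x : ι → Pt} {y : Pt} :
    y ∈ convexHull ℝ (range x) ↔ ∃ w ∈ stdSimplex ℝ ι, ∑ i, w i • x i = y := by
  constructor
  · intro hy
    have hconv : Convex ℝ (Fintype.linearCombination ℝ x '' stdSimplex ℝ ι) :=
      (convex_stdSimplex ℝ ι).linear_image _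
    have hsub : range x ⊆ Fintype.linearCombination ℝ x '' stdSimplex ℝ ι := by
      classical
      rintro _ ⟨i, rfl⟩
      exact ⟨Pi.single i 1, single_mem_stdSimplex ℝ i, by simp⟩
    obtain ⟨w, hw, rfl⟩ := convexHull_min hsub hconv hy
    exact ⟨w, hw, (Fintype.linearCombination_apply ℝ x w).symm⟩
  · rintro ⟨w, hw, rfl⟩
    exact mem_convexHull_of_exists_fintype w x hw.1 hw.2 (fun i => mem_range_self i) rfl

variable {n : ℕ}

lemma nullMeasurableSet_of_generic {p q : (Fin n → Pt) → Prop} (hq : MeasurableSet {x | q x})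
    (h : ∀ x ∈ genericConf n, (p x ↔ q x)) : NullMeasurableSet {x | p x} (conf n) := by
  refine hq.nullMeasurableSet.congr ?_
  filter_upwards [ae_mem_genericConf n] with x hx
  exact propext (h x hx).symm

lemma image_triple (x : Fin n → Pt) (i j l : Fin n) :
    Finset.image x {i, j, l} = {x i, x j, x l} := by
  simp [Finset.image_insert]

lemma nullMeasurableSet_disjoint_interior {t s : Finset (Fin n)} (ht : t.card = 3)
    (hs : s.card = 3) :
    NullMeasurableSet {x : Fin n → Pt |
      interior (triSet (t.image x)) ∩ interior (triSet (s.image x)) = ∅} (conf n) := by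
  obtain ⟨a, b, c, hab, hac, hbc, rfl⟩ := Finset.card_eq_three.1 ht
  obtain ⟨a', b', c', hab', hac', hbc', rfl⟩ := Finset.card_eq_three.1 hs
  let U : Pt → Set (Fin n → Pt) := fun q =>
    {x | (0 < orient (x a) (x b) (x c) * orient q (x b) (x c) ∧
      0 < orient (x a) (x b) (x c) * orient (x a) q (x c) ∧
      0 < orient (x a) (x b) (x c) * orient (x a) (x b) q) ∧
      (0 < orient (x a') (x b') (x c') * orient q (x b') (x c') ∧
      0 < orient (x a') (x b') (x c') * orient (x a') q (x c') ∧
      0 < orient (x a') (x b') (x c') * orient (x a') (x b') q)}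
  have hU : ∀ q, IsOpen (U q) := by
    intro q
    have key : ∀ {f g h f' g' h' : (Fin n → Pt) → Pt}, Continuous f → Continuous g →
        Continuous h → Continuous f' → Continuous g' → Continuous h' →
        IsOpen {x | 0 < orient (f x) (g x) (h x) * orient (f' x) (g' x) (h' x)} :=
      fun h1 h2 h3 h4 h5 h6 => isOpen_lt continuous_const
        ((continuous_orient h1 h2 h3).mul (continuous_orient h4 h5 h6))
    refine ((key ?_ ?_ ?_ ?_ ?_ ?_).inter ((key ?_ ?_ ?_ ?_ ?_ ?_).inter
      (key ?_ ?_ ?_ ?_ ?_ ?_))).inter ((key ?_ ?_ ?_ ?_ ?_ ?_).inter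
      ((key ?_ ?_ ?_ ?_ ?_ ?_).inter (key ?_ ?_ ?_ ?_ ?_ ?_)))
    all_goals fun_prop
  refine nullMeasurableSet_of_generic (q := fun x => x ∉ ⋃ q, U q)
    (isOpen_iUnion hU).measurableSet.compl fun x hx => ?_
  simp only [image_triple, mem_iUnion, not_exists, eq_empty_iff_forall_notMem, mem_inter_iff,
    mem_interior_triSet_iff (hx.2.1 a b c hab hac hbc),
    mem_interior_triSet_iff (hx.2.1 a' b' c' hab' hac' hbc'), U, mem_ofPred_eq]

lemma nullMeasurableSet_covers {τ : Finset (Finset (Fin n))} (hτ : ∀ t ∈ τ, t.card = 3) :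
    NullMeasurableSet {x : Fin n → Pt |
      convexHull ℝ (range x) ⊆ ⋃ t ∈ τ, triSet (t.image x)} (conf n) := by
  rcases isEmpty_or_nonempty (Fin n) with hn | hn
  · exact (toFinite _).nullMeasurableSet
  choose! a b c hab hac hbc habc using fun t ht => Finset.card_eq_three.1 (hτ t ht)
  let C : (Fin n → ℝ) → Set (Fin n → Pt) := fun w => ⋃ t ∈ τ,
    {x | 0 ≤ orient (x (a t)) (x (b t)) (x (c t)) *
        orient (∑ i, w i • x i) (x (b t)) (x (c t)) ∧
      0 ≤ orient (x (a t)) (x (b t)) (x (c t)) *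
        orient (x (a t)) (∑ i, w i • x i) (x (c t)) ∧
      0 ≤ orient (x (a t)) (x (b t)) (x (c t)) *
        orient (x (a t)) (x (b t)) (∑ i, w i • x i)}
  have hC : ∀ w, IsClosed (C w) := by
    intro w
    have key : ∀ {f g h f' g' h' : (Fin n → Pt) → Pt}, Continuous f → Continuous g →
        Continuous h → Continuous f' → Continuous g' → Continuous h' →
        IsClosed {x | 0 ≤ orient (f x) (g x) (h x) * orient (f' x) (g' x) (h' x)} :=
      fun h1 h2 h3 h4 h5 h6 => isClosed_le continuous_const
        ((continuous_orient h1 h2 h3).mul (continuous_orient h4 h5 h6))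
    refine isClosed_biUnion_finset fun t _ => (key ?_ ?_ ?_ ?_ ?_ ?_).inter
      ((key ?_ ?_ ?_ ?_ ?_ ?_).inter (key ?_ ?_ ?_ ?_ ?_ ?_))
    all_goals fun_prop
  refine nullMeasurableSet_of_generic (q := fun x => x ∈ ⋂ w ∈ stdSimplex ℝ (Fin n), C w)
    (isClosed_biInter fun w _ => hC w).measurableSet fun x hx => ?_
  have htri : ∀ t ∈ τ, ∀ q, q ∈ triSet (t.image x) ↔
      0 ≤ orient (x (a t)) (x (b t)) (x (c t)) * orient q (x (b t)) (x (c t)) ∧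
      0 ≤ orient (x (a t)) (x (b t)) (x (c t)) * orient (x (a t)) q (x (c t)) ∧
      0 ≤ orient (x (a t)) (x (b t)) (x (c t)) * orient (x (a t)) (x (b t)) q := by
    intro t ht q
    rw [← mem_triSet_iff (hx.2.1 (a t) (b t) (c t) (hab t ht) (hac t ht) (hbc t ht)),
      ← image_triple, ← habc t ht]
  constructor
  · intro h
    refine mem_iInter₂.2 fun w hw => ?_
    obtain ⟨t, ht, hq⟩ := mem_iUnion₂.1 (h (mem_convexHull_range_iff.2 ⟨w, hw, rfl⟩))
    exact mem_iUnion₂.2 ⟨t, ht, (htri t ht _).1 hq⟩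
  · intro h q hq
    obtain ⟨w, hw, rfl⟩ := mem_convexHull_range_iff.1 hq
    obtain ⟨t, ht, hm⟩ := mem_iUnion₂.1 (mem_iInter₂.1 h w hw)
    exact mem_iUnion₂.2 ⟨t, ht, (htri t ht _).2 hm⟩

lemma nullMeasurableSet_orderKTri {t : Finset (Fin n)} (ht : t.card = 3) (k : ℕ) :
    NullMeasurableSet {x : Fin n → Pt | OrderKTri (range x) k (t.image x)} (conf n) := by
  classical
  obtain ⟨a, b, c, hab, hac, hbc, rfl⟩ := Finset.card_eq_three.1 ht
  let U : Fin n → Set (Fin n → Pt) := fun j =>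
    {x | orient (x a) (x b) (x c) * inCirc (x a) (x b) (x c) (x j) < 0}
  have hU : ∀ j, IsOpen (U j) := fun j => by
    refine isOpen_lt ((continuous_orient ?_ ?_ ?_).mul (continuous_inCirc ?_ ?_ ?_ ?_))
      continuous_const
    all_goals fun_prop
  refine nullMeasurableSet_of_generic
    (q := fun x => x ∈ ⋂ J : Finset (Fin n), {x | (∀ j ∈ J, x ∈ U j) → J.card ≤ k}) ?_
    fun x hx => ?_
  · refine MeasurableSet.iInter fun J => MeasurableSet.imp ?_ (MeasurableSet.const _)
    have : {x : Fin n → Pt | ∀ j ∈ J, x ∈ U j} = ⋂ j ∈ J, U j := by ext; simp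
    rw [this]
    exact J.measurableSet_biInter fun j _ => (hU j).measurableSet
  · have e : {p ∈ range x | orient (x a) (x b) (x c) * inCirc (x a) (x b) (x c) p < 0} =
        x '' ((Finset.univ.filter fun j => x ∈ U j : Finset (Fin n)) : Set (Fin n)) := by
      ext p
      constructor
      · rintro ⟨⟨j, rfl⟩, h⟩
        exact ⟨j, by simpa [U] using h, rfl⟩
      · rintro ⟨j, hj, rfl⟩
        exact ⟨⟨j, rfl⟩, by simpa [U] using hj⟩
    rw [image_triple, orderKTri_iff (hx.2.1 a b c hab hac hbc), e,
      (injective_of_mem_genericConf hx).encard_image, encard_coe_eq_coe_finsetCard,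
      Nat.cast_le, mem_iInter]
    constructor
    · intro h J hJ
      exact (Finset.card_le_card fun j hj => by simpa using hJ j hj).trans h
    · intro h
      exact h _ fun j hj => by simpa using hj

/-- The triangles on `x` with the given index sets. -/
def trisOf (x : Fin n → Pt) (τ : Finset (Finset (Fin n))) : Set (Finset Pt) :=
  (Finset.image x) '' (τ : Set (Finset (Fin n)))

lemma trisOf_injective {x : Fin n → Pt} (hx : Function.Injective x) :
    Function.Injective (trisOf x) := fun _ _ h =>
  Finset.coe_injective ((Finset.image_injective hx).image_injective h)

lemma isOrderDT_trisOf_iff {x : Fin n → Pt} (hx : Function.Injective x) (k : ℕ)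
    (τ : Finset (Finset (Fin n))) :
    IsOrderDT (range x) k (trisOf x τ) ↔
      (∀ t ∈ τ, t.card = 3) ∧ (∀ i, ∃ t ∈ τ, i ∈ t) ∧
      (∀ t ∈ τ, ∀ s ∈ τ, t ≠ s →
        interior (triSet (t.image x)) ∩ interior (triSet (s.image x)) = ∅) ∧
      (convexHull ℝ (range x) ⊆ ⋃ t ∈ τ, triSet (t.image x)) ∧
      ∀ t ∈ τ, OrderKTri (range x) k (t.image x) := by
  have hsub : ∀ t : Finset (Fin n), ((t.image x : Finset Pt) : Set Pt) ⊆ range x := by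
    intro t
    simp only [Finset.coe_image]
    exact image_subset_range x _
  have hU : (⋃ t ∈ τ, triSet (t.image x)) ⊆ convexHull ℝ (range x) :=
    iUnion₂_subset fun t _ => triSet_subset (hsub t)
  unfold IsOrderDT IsTriangulation trisOf
  rw [biUnion_image]
  constructor
  · rintro ⟨⟨-, h1, h2, h3, h4⟩, h5⟩
    refine ⟨fun t ht => ?_, fun i => ?_, fun t ht s hs hne => ?_, h4.ge, fun t ht => ?_⟩
    · rw [← (h1 _ (mem_image_of_mem _ ht)).1, Finset.card_image_of_injective _ hx]
    · obtain ⟨_, ⟨t, ht, rfl⟩, hi⟩ := h2 (x i) (mem_range_self i)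
      exact ⟨t, ht, by simpa [hx.eq_iff] using hi⟩
    · exact h3 (mem_image_of_mem _ ht) (mem_image_of_mem _ hs)
        fun h => hne (Finset.image_injective hx h)
    · exact h5 _ (mem_image_of_mem _ ht)
  · rintro ⟨h1, h2, h3, h4, h5⟩
    refine ⟨⟨τ.finite_toSet.image _, ?_, ?_, ?_, hU.antisymm h4⟩, ?_⟩
    · rintro _ ⟨t, ht, rfl⟩
      exact ⟨by rw [Finset.card_image_of_injective _ hx, h1 t ht], hsub t⟩
    · rintro _ ⟨i, rfl⟩
      obtain ⟨t, ht, hi⟩ := h2 i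
      exact ⟨_, mem_image_of_mem _ ht, Finset.mem_image_of_mem _ hi⟩
    · rintro _ ⟨t, ht, rfl⟩ _ ⟨s, hs, rfl⟩ hne
      exact h3 t ht s hs fun h => hne (by rw [h])
    · rintro _ ⟨t, ht, rfl⟩
      exact h5 t ht

lemma nullMeasurableSet_isOrderDT (k : ℕ) (τ : Finset (Finset (Fin n))) :
    NullMeasurableSet {x : Fin n → Pt | IsOrderDT (range x) k (trisOf x τ)} (conf n) := by
  by_cases hτ : (∀ t ∈ τ, t.card = 3) ∧ ∀ i, ∃ t ∈ τ, i ∈ t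
  · have h3 : NullMeasurableSet (⋂ t ∈ τ, ⋂ s ∈ τ, ⋂ _ : t ≠ s, {x : Fin n → Pt |
        interior (triSet (t.image x)) ∩ interior (triSet (s.image x)) = ∅}) (conf n) :=
      τ.nullMeasurableSet_biInter fun t ht => τ.nullMeasurableSet_biInter fun s hs =>
        NullMeasurableSet.iInter fun _ =>
          nullMeasurableSet_disjoint_interior (hτ.1 t ht) (hτ.1 s hs)
    have h5 : NullMeasurableSet (⋂ t ∈ τ, {x : Fin n → Pt |
        OrderKTri (range x) k (t.image x)}) (conf n) :=
      τ.nullMeasurableSet_biInter fun t ht => nullMeasurableSet_orderKTri (hτ.1 t ht) k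
    refine (h3.inter ((nullMeasurableSet_covers hτ.1).inter h5)).congr (eventuallyEq_set.2 ?_)
    filter_upwards [ae_mem_genericConf n] with x hx
    simp only [mem_inter_iff, mem_iInter, mem_ofPred_eq,
      isOrderDT_trisOf_iff (injective_of_mem_genericConf hx)]
    tauto
  · refine (MeasurableSet.empty.nullMeasurableSet).congr (eventuallyEq_set.2 ?_)
    filter_upwards [ae_mem_genericConf n] with x hx
    simp only [mem_empty_iff_false, false_iff,
      isOrderDT_trisOf_iff (injective_of_mem_genericConf hx)]
    tauto

lemma nullMeasurableSet_exactOrderDTs (k : ℕ) (τ : Finset (Finset (Fin n))) :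
    NullMeasurableSet {x : Fin n → Pt | trisOf x τ ∈ exactOrderDTs (range x) k} (conf n) := by
  have : {x : Fin n → Pt | trisOf x τ ∈ exactOrderDTs (range x) k} =
      {x | IsOrderDT (range x) k (trisOf x τ)} ∩
        ⋂ i ∈ Finset.range k, {x | IsOrderDT (range x) i (trisOf x τ)}ᶜ := by
    ext x; simp [exactOrderDTs]
  rw [this]
  exact (nullMeasurableSet_isOrderDT k τ).inter
    ((Finset.range k).nullMeasurableSet_biInter fun i _ => (nullMeasurableSet_isOrderDT i τ).compl)

lemma ncard_exactOrderDTs_eq_sum {x : Fin n → Pt} (hx : Function.Injective x) (k : ℕ) :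
    ((exactOrderDTs (range x) k).ncard : ℝ) =
      ∑ τ : Finset (Finset (Fin n)),
        {x : Fin n → Pt | trisOf x τ ∈ exactOrderDTs (range x) k}.indicator 1 x := by
  classical
  have hsub : exactOrderDTs (range x) k ⊆ range (trisOf x) := by
    intro T hT
    have hT' : T ⊆ range (Finset.image x) := by
      intro t ht
      have := (hT.1.1.2.1 t ht).2
      refine ⟨t.preimage x hx.injOn, ?_⟩
      rw [Finset.image_preimage_of_bij]
      exact ⟨fun _ h => h, hx.injOn, fun p hp => by
        obtain ⟨i, rfl⟩ := this hp
        exact ⟨i, hp, rfl⟩⟩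
    obtain ⟨τ, rfl⟩ := subset_range_iff_exists_image_eq.1 hT'
    exact ⟨τ.toFinite.toFinset, by simp [trisOf]⟩
  rw [← ncard_preimage_of_injective_subset_range (trisOf_injective hx) hsub,
    ncard_eq_toFinset_card']
  simp only [indicator_apply, Pi.one_apply, mem_ofPred_eq]
  rw [Finset.sum_boole]
  congr 2
  ext τ
  simp

lemma integrable_ncard_exactOrderDTs (n k : ℕ) :
    Integrable (fun x : Fin n → Pt => ((exactOrderDTs (range x) k).ncard : ℝ)) (conf n) := by
  refine Integrable.of_bound (C := ((2 ^ (2 ^ (k + 3) * n) : ℕ) : ℝ)) ?_ ?_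
  · refine AEStronglyMeasurable.congr (f := fun x => ∑ τ : Finset (Finset (Fin n)),
      {x : Fin n → Pt | trisOf x τ ∈ exactOrderDTs (range x) k}.indicator (1 : (Fin n → Pt) → ℝ) x) ?_ ?_
    · refine Finset.aestronglyMeasurable_fun_sum _ fun τ _ => ?_
      exact (aestronglyMeasurable_const (b := (1 : ℝ))).indicator₀
        (nullMeasurableSet_exactOrderDTs k τ)
    · filter_upwards [ae_mem_genericConf n] with x hx
      exact (ncard_exactOrderDTs_eq_sum (injective_of_mem_genericConf hx) k).symm
  · filter_upwards [ae_mem_genericConf n] with x hx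
    rw [Real.norm_of_nonneg (Nat.cast_nonneg _)]
    exact_mod_cast ncard_exactOrderDTs_range_le hx k

lemma integral_ncard_exactOrderDTs_le (n k : ℕ) :
    ∫ x : Fin n → Pt, ((exactOrderDTs (range x) k).ncard : ℝ) ∂conf n ≤
      2 ^ (2 ^ (k + 3) * n) := by
  have := integral_mono_ae (μ := conf n) (integrable_ncard_exactOrderDTs n k)
    (integrable_const ((2 ^ (2 ^ (k + 3) * n) : ℕ) : ℝ)) (by
      filter_upwards [ae_mem_genericConf n] with x hx
      exact_mod_cast ncard_exactOrderDTs_range_le hx k)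
  simpa using this

end Measurability

/-! ### Gadgets forcing a flippable quadrilateral -/

section Gadget

lemma mul_neg_iff_of_pos {a b : ℝ} (ha : 0 < a) : a * b < 0 ↔ b < 0 := by
  rw [mul_neg_iff]
  simp [ha, ha.not_gt]

lemma orient_smul_add (z : Pt) (s : ℝ) (a b c : Pt) :
    orient (z + s • a) (z + s • b) (z + s • c) = s ^ 2 * orient a b c := by
  simp only [orient, PiLp.add_apply, PiLp.smul_apply, smul_eq_mul]; ring

lemma inCirc_smul_add (z : Pt) (s : ℝ) (a b c p : Pt) :
    inCirc (z + s • a) (z + s • b) (z + s • c) (z + s • p) = s ^ 4 * inCirc a b c p := by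
  simp only [inCirc, orient, nsq, PiLp.add_apply, PiLp.smul_apply, smul_eq_mul]; ring

/-- Open conditions keeping the circumdisk of `a b c` inside the disk of radius `10`. -/
structure CircNearOrigin (a b c : Pt) : Prop where
  fst : |inCirc a b c !₂[1, 0] - inCirc a b c !₂[-1, 0]| < 6 * orient a b c
  snd : |inCirc a b c !₂[0, 1] - inCirc a b c !₂[0, -1]| < 6 * orient a b c
  zero : -40 * orient a b c < inCirc a b c 0

lemma CircNearOrigin.inCirc_pos {a b c : Pt} (h : CircNearOrigin a b c) {p : Pt}
    (hp : 100 ≤ nsq p) : 0 < inCirc a b c p := by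
  obtain ⟨u, v, w, he⟩ := inCirc_expand a b c
  obtain ⟨h1, h2, h3⟩ := h
  have e1 : inCirc a b c !₂[1, 0] - inCirc a b c !₂[-1, 0] = 2 * u := by
    rw [he, he]; simp [nsq]; ring
  have e2 : inCirc a b c !₂[0, 1] - inCirc a b c !₂[0, -1] = 2 * v := by
    rw [he, he]; simp [nsq]; ring
  have e3 : inCirc a b c 0 = w := by rw [he]; simp [nsq]
  rw [e1, abs_mul, abs_two] at h1
  rw [e2, abs_mul, abs_two] at h2
  rw [e3] at h3
  rw [he]
  set o := orient a b c
  have ho : 0 < o := by linarith [abs_nonneg u]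
  have hu : |u * p 0| ≤ 3 * o * |p 0| := by
    rw [abs_mul]; exact mul_le_mul_of_nonneg_right (by linarith) (abs_nonneg _)
  have hv : |v * p 1| ≤ 3 * o * |p 1| := by
    rw [abs_mul]; exact mul_le_mul_of_nonneg_right (by linarith) (abs_nonneg _)
  have hu' := (abs_le.1 hu).1
  have hv' := (abs_le.1 hv).1
  have hsum : 3 * |p 0| + 3 * |p 1| + 40 ≤ nsq p := by
    unfold nsq at hp ⊢
    nlinarith [sq_nonneg (|p 0| - 7), sq_nonneg (|p 1| - 7), sq_abs (p 0), sq_abs (p 1)]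
  nlinarith [mul_le_mul_of_nonneg_left hsum ho.le]

/-- Open conditions on a quadrilateral `a b c d` and an extra point `e`: the diagonal `ac` is
locally Delaunay, and flipping it creates a triangle whose circumdisk contains `c` and `e`. -/
structure FlipPattern (a b c d e : Pt) : Prop where
  abc : 0 < orient a b c
  acd : 0 < orient a c d
  abd : 0 < orient a b d
  bcd : 0 < orient b c d
  abc_d : 0 < inCirc a b c d
  abc_e : 0 < inCirc a b c e
  acd_b : 0 < inCirc a c d b
  acd_e : 0 < inCirc a c d e
  abd_c : inCirc a b d c < 0
  abd_e : inCirc a b d e < 0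
  bcd_e : 0 < inCirc b c d e
  near_abc : CircNearOrigin a b c
  near_acd : CircNearOrigin a c d
  near_abd : CircNearOrigin a b d
  near_bcd : CircNearOrigin b c d

/-- The model flippable quadrilateral, together with the model position of the extra points. -/
def modelPattern : Fin 5 → Pt := ![!₂[0, -4], !₂[5, 0], !₂[0, 4], !₂[-5, 0], !₂[0, 5]]

lemma flipPattern_model : FlipPattern (modelPattern 0) (modelPattern 1) (modelPattern 2)
    (modelPattern 3) (modelPattern 4) := by
  constructor <;> try constructor
  all_goals
    simp [modelPattern, inCirc, orient, nsq]
    try norm_num [abs_lt]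

lemma norm_modelPattern_le (i : Fin 5) : ‖modelPattern i‖ ≤ 5 := by
  rw [EuclideanSpace.norm_eq]
  apply Real.sqrt_le_iff.2
  fin_cases i <;> simp [modelPattern, Fin.sum_univ_two] <;> norm_num

lemma isOpen_circNearOrigin {X : Type*} [TopologicalSpace X] {f g h : X → Pt} (hf : Continuous f)
    (hg : Continuous g) (hh : Continuous h) :
    IsOpen {x | CircNearOrigin (f x) (g x) (h x)} := by
  have ho := continuous_orient hf hg hh
  have hi : ∀ p : Pt, Continuous fun x => inCirc (f x) (g x) (h x) p :=
    fun p => continuous_inCirc hf hg hh continuous_const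
  have e : {x | CircNearOrigin (f x) (g x) (h x)} = {x |
      |inCirc (f x) (g x) (h x) !₂[1, 0] - inCirc (f x) (g x) (h x) !₂[-1, 0]| <
        6 * orient (f x) (g x) (h x) ∧
      |inCirc (f x) (g x) (h x) !₂[0, 1] - inCirc (f x) (g x) (h x) !₂[0, -1]| <
        6 * orient (f x) (g x) (h x) ∧
      -40 * orient (f x) (g x) (h x) < inCirc (f x) (g x) (h x) 0} := by
    ext x
    exact ⟨fun h => ⟨h.1, h.2, h.3⟩, fun h => ⟨h.1, h.2.1, h.2.2⟩⟩
  rw [e]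
  exact (isOpen_lt ((hi _).sub (hi _)).abs (continuous_const.mul ho)).inter
    ((isOpen_lt ((hi _).sub (hi _)).abs (continuous_const.mul ho)).inter
      (isOpen_lt (continuous_const.mul ho) (hi 0)))

lemma isOpen_flipPattern :
    IsOpen {y : Fin 5 → Pt | FlipPattern (y 0) (y 1) (y 2) (y 3) (y 4)} := by
  have ho : ∀ i j l : Fin 5, IsOpen {y : Fin 5 → Pt | 0 < orient (y i) (y j) (y l)} :=
    fun i j l => isOpen_lt continuous_const (continuous_orient (continuous_apply i)
      (continuous_apply j) (continuous_apply l))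
  have hi : ∀ i j l m : Fin 5, IsOpen {y : Fin 5 → Pt | 0 < inCirc (y i) (y j) (y l) (y m)} :=
    fun i j l m => isOpen_lt continuous_const (continuous_inCirc (continuous_apply i)
      (continuous_apply j) (continuous_apply l) (continuous_apply m))
  have hi' : ∀ i j l m : Fin 5, IsOpen {y : Fin 5 → Pt | inCirc (y i) (y j) (y l) (y m) < 0} :=
    fun i j l m => isOpen_lt (continuous_inCirc (continuous_apply i)
      (continuous_apply j) (continuous_apply l) (continuous_apply m)) continuous_const
  have hn : ∀ i j l : Fin 5, IsOpen {y : Fin 5 → Pt | CircNearOrigin (y i) (y j) (y l)} :=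
    fun i j l => isOpen_circNearOrigin (continuous_apply i) (continuous_apply j)
      (continuous_apply l)
  convert (ho 0 1 2).inter <| (ho 0 2 3).inter <| (ho 0 1 3).inter <| (ho 1 2 3).inter <|
    (hi 0 1 2 3).inter <| (hi 0 1 2 4).inter <| (hi 0 2 3 1).inter <| (hi 0 2 3 4).inter <|
    (hi' 0 1 3 2).inter <| (hi' 0 1 3 4).inter <| (hi 1 2 3 4).inter <| (hn 0 1 2).inter <|
    (hn 0 2 3).inter <| (hn 0 1 3).inter (hn 1 2 3) using 1
  ext y
  exact ⟨fun h => ⟨h.1, h.2, h.3, h.4, h.5, h.6, h.7, h.8, h.9, h.10, h.11, h.12, h.13, h.14,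
    h.15⟩, fun ⟨h1, h2, h3, h4, h5, h6, h7, h8, h9, h10, h11, h12, h13, h14, h15⟩ =>
      ⟨h1, h2, h3, h4, h5, h6, h7, h8, h9, h10, h11, h12, h13, h14, h15⟩⟩

/-- Small perturbations of the model remain flip patterns. -/
lemma exists_flipPattern_radius : ∃ ε : ℝ, 0 < ε ∧ ε ≤ 1 ∧ ∀ y : Fin 5 → Pt,
    (∀ i, dist (y i) (modelPattern i) < ε) → FlipPattern (y 0) (y 1) (y 2) (y 3) (y 4) := by
  obtain ⟨ε, hε, h⟩ := Metric.isOpen_iff.1 isOpen_flipPattern modelPattern flipPattern_model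
  refine ⟨min ε 1, lt_min hε one_pos, min_le_right _ _, fun y hy => h ?_⟩
  exact (dist_pi_lt_iff hε).2 fun i => (hy i).trans_le (min_le_left _ _)

/-- The model position of each gadget point: four vertices and `k` extra points. -/
def gadgetModel {k : ℕ} (j : Fin 4 ⊕ Fin k) : Pt :=
  modelPattern (Sum.elim (Fin.castSucc : Fin 4 → Fin 5) (fun _ => 4) j)

/-- A configuration close to the scaled model, with no further points nearby, contains a
quadrilateral whose flip has order exactly `k + 1`. -/
lemma flipQuad_of_gadget {k : ℕ} {ε : ℝ} (hpat : ∀ y : Fin 5 → Pt,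
    (∀ i, dist (y i) (modelPattern i) < ε) → FlipPattern (y 0) (y 1) (y 2) (y 3) (y 4))
    (hε : 0 < ε) {P : Set Pt} {z : Pt} {s : ℝ} (hs : 0 < s) {y : Fin 4 ⊕ Fin k → Pt}
    (hy : ∀ j, dist (y j) (gadgetModel j) < ε) (hinj : Function.Injective y)
    (hmem : ∀ j, z + s • y j ∈ P)
    (hfar : ∀ p ∈ P, (∃ j, p = z + s • y j) ∨ ∃ q, 100 ≤ nsq q ∧ p = z + s • q) :
    FlipQuad P (k + 1) (z + s • y (Sum.inl 0)) (z + s • y (Sum.inl 1)) (z + s • y (Sum.inl 2))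
      (z + s • y (Sum.inl 3)) := by
  classical
  have hs2 : 0 < s ^ 2 := by positivity
  have hs4 : 0 < s ^ 4 := by positivity
  have hbase : ∀ e, dist e (modelPattern 4) < ε → FlipPattern (y (Sum.inl 0)) (y (Sum.inl 1))
      (y (Sum.inl 2)) (y (Sum.inl 3)) e := by
    intro e he
    refine hpat ![y (Sum.inl 0), y (Sum.inl 1), y (Sum.inl 2), y (Sum.inl 3), e] fun i => ?_
    fin_cases i
    exacts [hy (Sum.inl 0), hy (Sum.inl 1), hy (Sum.inl 2), hy (Sum.inl 3), he]
  have h0 := hbase (modelPattern 4) (by simpa using hε)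
  have hex : ∀ l : Fin k, FlipPattern (y (Sum.inl 0)) (y (Sum.inl 1))
      (y (Sum.inl 2)) (y (Sum.inl 3)) (y (Sum.inr l)) := fun l => hbase _ (hy (Sum.inr l))
  have hzinj : Function.Injective fun j => z + s • y j := by
    intro i j hij
    exact hinj (smul_right_injective _ hs.ne' (add_left_cancel hij))
  have hset : {p ∈ P | orient (z + s • y (Sum.inl 0)) (z + s • y (Sum.inl 1))
      (z + s • y (Sum.inl 3)) * inCirc (z + s • y (Sum.inl 0)) (z + s • y (Sum.inl 1))
      (z + s • y (Sum.inl 3)) p < 0} = (fun j => z + s • y j) ''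
        ((Finset.univ \ {Sum.inl 0, Sum.inl 1, Sum.inl 3} : Finset (Fin 4 ⊕ Fin k)) :
          Set (Fin 4 ⊕ Fin k)) := by
    have hself := inCirc_self (y (Sum.inl 0)) (y (Sum.inl 1)) (y (Sum.inl 3))
    have hiff : ∀ q, orient (z + s • y (Sum.inl 0)) (z + s • y (Sum.inl 1))
        (z + s • y (Sum.inl 3)) * inCirc (z + s • y (Sum.inl 0)) (z + s • y (Sum.inl 1))
        (z + s • y (Sum.inl 3)) (z + s • q) < 0 ↔
        inCirc (y (Sum.inl 0)) (y (Sum.inl 1)) (y (Sum.inl 3)) q < 0 := by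
      intro q
      rw [orient_smul_add, inCirc_smul_add]
      have h3 := h0.abd
      rw [mul_neg_iff_of_pos (by positivity), mul_neg_iff_of_pos hs4]
    ext p
    constructor
    · rintro ⟨hp, hneg⟩
      rcases hfar p hp with ⟨j, rfl⟩ | ⟨q, hq, rfl⟩
      · rw [hiff] at hneg
        refine ⟨j, ?_, rfl⟩
        simp only [Finset.coe_sdiff, Finset.coe_univ, mem_sdiff, mem_univ, true_and,
          Finset.coe_insert, Finset.coe_singleton, mem_insert_iff, mem_singleton_iff, not_or]
        refine ⟨?_, ?_, ?_⟩ <;> rintro rfl <;> simp [hself] at hneg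
      · rw [hiff] at hneg
        exact absurd (h0.near_abd.inCirc_pos hq) hneg.not_gt
    · rintro ⟨j, hj, rfl⟩
      refine ⟨hmem j, (hiff _).2 ?_⟩
      rcases j with j | l
      · fin_cases j
        · simp at hj
        · simp at hj
        · exact h0.abd_c
        · simp at hj
      · exact (hex l).abd_e
  have hcard : {p ∈ P | orient (z + s • y (Sum.inl 0)) (z + s • y (Sum.inl 1))
      (z + s • y (Sum.inl 3)) * inCirc (z + s • y (Sum.inl 0)) (z + s • y (Sum.inl 1))
      (z + s • y (Sum.inl 3)) p < 0}.encard = ((k + 1 : ℕ) : ℕ∞) := by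
    rw [hset, hzinj.encard_image, encard_coe_eq_coe_finsetCard,
      Finset.card_sdiff_of_subset (Finset.subset_univ _)]
    congr 1
    simp
    omega
  have habd : orient (z + s • y (Sum.inl 0)) (z + s • y (Sum.inl 1)) (z + s • y (Sum.inl 3)) ≠ 0 := by
    rw [orient_smul_add]; exact (mul_pos hs2 h0.abd).ne'
  have hdel : ∀ a b c : Pt, CircNearOrigin a b c → 0 < orient a b c →
      (∀ j, 0 ≤ inCirc a b c (y j)) → OrderKTri P 0 {z + s • a, z + s • b, z + s • c} := by
    intro a b c hnear hor hj
    rw [orderKTri_zero_iff (by rw [orient_smul_add]; positivity)]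
    intro p hp
    rcases hfar p hp with ⟨j, rfl⟩ | ⟨q, hq, rfl⟩
    · rw [inCirc_smul_add]; exact mul_nonneg hs4.le (hj j)
    · rw [inCirc_smul_add]; exact (mul_pos hs4 (hnear.inCirc_pos hq)).le
  refine ⟨hmem _, hmem _, hmem _, hmem _, ?_, ?_, ?_, ?_, ?_, ?_, ?_, ?_, ?_⟩
  · rw [orient_smul_add]; exact mul_pos hs2 h0.abc
  · rw [orient_smul_add]; exact mul_pos hs2 h0.acd
  · rw [orient_smul_add]; exact mul_pos hs2 h0.abd
  · rw [orient_smul_add]; exact mul_pos hs2 h0.bcd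
  · refine hdel _ _ _ h0.near_abc h0.abc ?_
    have hself := inCirc_self (y (Sum.inl 0)) (y (Sum.inl 1)) (y (Sum.inl 2))
    rintro (j | l)
    · fin_cases j
      exacts [hself.1.ge, hself.2.1.ge, hself.2.2.ge, h0.abc_d.le]
    · exact (hex l).abc_e.le
  · refine hdel _ _ _ h0.near_acd h0.acd ?_
    have hself := inCirc_self (y (Sum.inl 0)) (y (Sum.inl 2)) (y (Sum.inl 3))
    rintro (j | l)
    · fin_cases j
      exacts [hself.1.ge, h0.acd_b.le, hself.2.1.ge, hself.2.2.ge]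
    · exact (hex l).acd_e.le
  · rw [orderKTri_iff habd, hcard]
  · have hbcd : 0 < orient (z + s • y (Sum.inl 1)) (z + s • y (Sum.inl 2))
        (z + s • y (Sum.inl 3)) := by rw [orient_smul_add]; exact mul_pos hs2 h0.bcd
    rw [orderKTri_iff hbcd.ne']
    refine le_trans (encard_le_encard (t := {z + s • y (Sum.inl 0)}) ?_) (by simp)
    rintro p ⟨hp, hneg⟩
    rw [mul_neg_iff_of_pos hbcd] at hneg
    have hself := inCirc_self (y (Sum.inl 1)) (y (Sum.inl 2)) (y (Sum.inl 3))
    rcases hfar p hp with ⟨j, rfl⟩ | ⟨q, hq, rfl⟩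
    · rw [inCirc_smul_add, mul_neg_iff_of_pos hs4] at hneg
      rcases j with j | l
      · fin_cases j
        · rfl
        · exact absurd hself.1 hneg.ne
        · exact absurd hself.2.1 hneg.ne
        · exact absurd hself.2.2 hneg.ne
      · exact absurd (hex l).bcd_e hneg.not_gt
    · rw [inCirc_smul_add, mul_neg_iff_of_pos hs4] at hneg
      exact absurd (h0.near_bcd.inCirc_pos hq) hneg.not_gt
  · rw [orderKTri_iff habd, hcard, not_le, Nat.add_sub_cancel]
    exact_mod_cast Nat.lt_succ_self k

end Gadget

/-! ### Many disjoint gadgets in a random configuration -/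

section Cells

open MeasureTheory

/-- The centre of a cell of the `s × s` grid subdividing the unit square. -/
def cellCenter (s : ℕ) (q : Fin s × Fin s) : Pt :=
  !₂[(2 * (q.1 : ℝ) + 1) / (2 * s), (2 * (q.2 : ℝ) + 1) / (2 * s)]

/-- The scale at which gadgets are placed in the `s × s` grid. -/
def gadgetScale (s : ℕ) : ℝ := (20 * (s : ℝ))⁻¹

/-- The disk inscribed in a cell. -/
def cellDisk (s : ℕ) (q : Fin s × Fin s) : Set Pt :=
  Metric.ball (cellCenter s q) (10 * gadgetScale s)

/-- The disk of admissible positions of the gadget point modelled on `p`. -/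
def slotDisk (s : ℕ) (ε : ℝ) (q : Fin s × Fin s) (p : Pt) : Set Pt :=
  Metric.ball (cellCenter s q + gadgetScale s • p) (gadgetScale s * ε)

variable {s : ℕ} {q q' : Fin s × Fin s} {ε : ℝ}

lemma gadgetScale_pos (q : Fin s × Fin s) : 0 < gadgetScale s := by
  have : 0 < s := q.1.pos
  unfold gadgetScale
  positivity

lemma floor_of_mem_cellDisk {p : Pt} (hp : p ∈ cellDisk s q) :
    ((q.1 : ℝ) < s * p 0 ∧ s * p 0 < q.1 + 1) ∧ (q.2 : ℝ) < s * p 1 ∧ s * p 1 < q.2 + 1 := by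
  have hs : (0 : ℝ) < s := by exact_mod_cast q.1.pos
  have hd : ‖p - cellCenter s q‖ < 10 * gadgetScale s := by
    simpa [cellDisk, dist_eq_norm] using hp
  have key : ∀ t u : ℝ, |t - (2 * u + 1) / (2 * s)| < 10 * gadgetScale s →
      u < s * t ∧ s * t < u + 1 := by
    intro t u h
    have h2 := mul_lt_mul_of_pos_left h hs
    rw [← abs_of_pos hs, ← abs_mul, abs_of_pos hs] at h2
    have e1 : s * (t - (2 * u + 1) / (2 * s)) = s * t - u - 1 / 2 := by
      field_simp; ring
    have e2 : s * (10 * gadgetScale s) = 1 / 2 := by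
      unfold gadgetScale; field_simp; norm_num
    rw [e1, e2, abs_lt] at h2
    constructor <;> linarith
  have h0 := (PiLp.norm_apply_le (p - cellCenter s q) 0).trans_lt hd
  have h1 := (PiLp.norm_apply_le (p - cellCenter s q) 1).trans_lt hd
  exact ⟨key _ _ (by simpa [cellCenter] using h0), key _ _ (by simpa [cellCenter] using h1)⟩

lemma cellDisk_subset_unitSq : cellDisk s q ⊆ unitSq := by
  intro p hp
  have hs : (0 : ℝ) < s := by exact_mod_cast q.1.pos
  have key : ∀ (t : ℝ) (u : Fin s), (u : ℝ) < s * t ∧ s * t < u + 1 → t ∈ Icc (0 : ℝ) 1 := by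
    rintro t u ⟨h1, h2⟩
    have h3 : (u : ℝ) + 1 ≤ s := by exact_mod_cast u.isLt
    have h4 : (0 : ℝ) ≤ u := Nat.cast_nonneg _
    exact ⟨by by_contra! h; nlinarith, by by_contra! h; nlinarith⟩
  obtain ⟨h0, h1⟩ := floor_of_mem_cellDisk hp
  exact ⟨key _ _ h0, key _ _ h1⟩

lemma cell_eq_of_mem_cellDisk {p : Pt} (hp : p ∈ cellDisk s q) (hp' : p ∈ cellDisk s q') :
    q = q' := by
  have key : ∀ (t : ℝ) (u v : Fin s), (u : ℝ) < t ∧ t < u + 1 → (v : ℝ) < t ∧ t < v + 1 →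
      u = v := by
    rintro t u v ⟨h1, h2⟩ ⟨h3, h4⟩
    have h5 : (u : ℝ) < v + 1 := h1.trans h4
    have h6 : (v : ℝ) < u + 1 := h3.trans h2
    norm_cast at h5 h6
    exact Fin.ext (by omega)
  obtain ⟨h0, h1⟩ := floor_of_mem_cellDisk hp
  obtain ⟨h0', h1'⟩ := floor_of_mem_cellDisk hp'
  exact Prod.ext (key _ _ _ h0 h0') (key _ _ _ h1 h1')

lemma slotDisk_subset_cellDisk (hε : ε ≤ 1) {p : Pt} (hp : ‖p‖ ≤ 5) :
    slotDisk s ε q p ⊆ cellDisk s q := by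
  have hs := gadgetScale_pos q
  refine Metric.ball_subset_ball' ?_
  rw [dist_eq_norm, add_sub_cancel_left, norm_smul, Real.norm_of_nonneg hs.le]
  nlinarith

lemma norm_gadgetModel_le {k : ℕ} (j : Fin 4 ⊕ Fin k) : ‖gadgetModel j‖ ≤ 5 :=
  norm_modelPattern_le _

lemma unifSq_real_ball {z : Pt} {r : ℝ} (hr : 0 ≤ r) (h : Metric.ball z r ⊆ unitSq) :
    unifSq.real (Metric.ball z r) = Real.pi * r ^ 2 := by
  rw [Measure.real, unifSq, Measure.restrict_eq_self _ h, EuclideanSpace.volume_ball_fin_two,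
    ENNReal.toReal_mul, ENNReal.toReal_pow, ENNReal.toReal_ofReal hr]
  simp [mul_comm, Real.pi_pos.le]

lemma unifSq_real_slotDisk (hε0 : 0 < ε) (hε : ε ≤ 1) {p : Pt} (hp : ‖p‖ ≤ 5) :
    unifSq.real (slotDisk s ε q p) = Real.pi * (gadgetScale s * ε) ^ 2 :=
  unifSq_real_ball (mul_pos (gadgetScale_pos q) hε0).le
    ((slotDisk_subset_cellDisk hε hp).trans cellDisk_subset_unitSq)

lemma le_unifSq_real_cellDisk_compl :
    1 - ((s : ℝ) ^ 2)⁻¹ ≤ unifSq.real (cellDisk s q)ᶜ := by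
  have hs : (0 : ℝ) < s := by exact_mod_cast q.1.pos
  have hc := gadgetScale_pos q
  rw [cellDisk, probReal_compl_eq_one_sub Metric.isOpen_ball.measurableSet,
    unifSq_real_ball (by positivity) cellDisk_subset_unitSq]
  have : Real.pi * (10 * gadgetScale s) ^ 2 = Real.pi / 4 * ((s : ℝ) ^ 2)⁻¹ := by
    unfold gadgetScale; field_simp; norm_num
  rw [this]
  have h2 : (0 : ℝ) ≤ ((s : ℝ) ^ 2)⁻¹ := by positivity
  nlinarith [Real.pi_le_four]

end Cells

section GadgetEvents

open MeasureTheory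

variable {k n s : ℕ} {ε : ℝ}

/-- The points indexed by `σ` form a gadget in the cell `q`, and the cell disk contains no other
points. -/
def gadgetEvent (ε : ℝ) (q : Fin s × Fin s) (σ : Fin 4 ⊕ Fin k → Fin n) : Set (Fin n → Pt) :=
  {x | (∀ j, x (σ j) ∈ slotDisk s ε q (gadgetModel j)) ∧ ∀ i, (∀ j, σ j ≠ i) → x i ∉ cellDisk s q}

lemma gadgetEvent_eq_pi (q : Fin s × Fin s) (σ : Fin 4 ⊕ Fin k → Fin n) :
    gadgetEvent ε q σ = univ.pi fun i => {p | (∀ j, σ j = i → p ∈ slotDisk s ε q (gadgetModel j)) ∧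
      ((∀ j, σ j ≠ i) → p ∉ cellDisk s q)} := by
  ext x
  simp only [gadgetEvent, mem_ofPred_eq, mem_univ_pi]
  constructor
  · rintro ⟨h1, h2⟩ i
    exact ⟨fun j hj => hj ▸ h1 j, h2 i⟩
  · exact fun h => ⟨fun j => (h (σ j)).1 j rfl, fun i => (h i).2⟩

lemma measurableSet_gadgetEvent (q : Fin s × Fin s) (σ : Fin 4 ⊕ Fin k → Fin n) :
    MeasurableSet (gadgetEvent ε q σ) := by
  have h1 : ∀ j, MeasurableSet {x : Fin n → Pt | x (σ j) ∈ slotDisk s ε q (gadgetModel j)} :=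
    fun j => measurable_pi_apply _ Metric.isOpen_ball.measurableSet
  have h2 : ∀ i, MeasurableSet {x : Fin n → Pt | (∀ j, σ j ≠ i) → x i ∉ cellDisk s q} :=
    fun i => (MeasurableSet.const _).imp
      (measurable_pi_apply i Metric.isOpen_ball.measurableSet).compl
  have e : gadgetEvent ε q σ = (⋂ j, {x | x (σ j) ∈ slotDisk s ε q (gadgetModel j)}) ∩
      ⋂ i, {x | (∀ j, σ j ≠ i) → x i ∉ cellDisk s q} := by
    ext x
    simp only [gadgetEvent, mem_inter_iff, mem_iInter, mem_ofPred_eq]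
  rw [e]
  exact (MeasurableSet.iInter h1).inter (MeasurableSet.iInter h2)

lemma le_conf_real_gadgetEvent (hε0 : 0 < ε) (hε : ε ≤ 1) (q : Fin s × Fin s)
    {σ : Fin 4 ⊕ Fin k → Fin n} (hσ : Function.Injective σ) :
    (Real.pi * (gadgetScale s * ε) ^ 2) ^ (4 + k) * (1 - ((s : ℝ) ^ 2)⁻¹) ^ n ≤
      (conf n).real (gadgetEvent ε q σ) := by
  have hs : (1 : ℝ) ≤ s := by exact_mod_cast q.1.pos
  have hs2 : ((s : ℝ) ^ 2)⁻¹ ≤ 1 := inv_le_one_of_one_le₀ (one_le_pow₀ hs)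
  have hs0 : (0 : ℝ) ≤ ((s : ℝ) ^ 2)⁻¹ := by positivity
  set b := Real.pi * (gadgetScale s * ε) ^ 2 with hb
  have hb0 : 0 ≤ b := by have := Real.pi_pos; positivity
  set r := 1 - ((s : ℝ) ^ 2)⁻¹ with hr
  have hr0 : 0 ≤ r := by linarith
  have hr1 : r ≤ 1 := by linarith
  rw [gadgetEvent_eq_pi, conf, Measure.real, Measure.pi_pi, ENNReal.toReal_prod]
  have hcard : (Finset.univ.image σ).card = 4 + k := by
    rw [Finset.card_image_of_injective _ hσ]; simp
  calc b ^ (4 + k) * r ^ n = ∏ i : Fin n, (if i ∈ Finset.univ.image σ then b else 1) * r := by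
        rw [Finset.prod_mul_distrib, Finset.prod_ite_mem]
        simp [hcard]
    _ ≤ _ := Finset.prod_le_prod (fun i _ => by positivity) fun i _ => ?_
  by_cases hi : i ∈ Finset.univ.image σ
  · obtain ⟨j, -, rfl⟩ := Finset.mem_image.1 hi
    have : {p : Pt | (∀ j', σ j' = σ j → p ∈ slotDisk s ε q (gadgetModel j')) ∧
        ((∀ j', σ j' ≠ σ j) → p ∉ cellDisk s q)} = slotDisk s ε q (gadgetModel j) := by
      ext p
      exact ⟨fun h => h.1 j rfl, fun h => ⟨fun j' hj' => hσ hj' ▸ h, fun h' => absurd rfl (h' j)⟩⟩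
    rw [if_pos hi, this]
    exact (mul_le_of_le_one_right hb0 hr1).trans
      (unifSq_real_slotDisk hε0 hε (norm_gadgetModel_le j)).ge
  · have hi' : ∀ j, σ j ≠ i := fun j hj => hi (Finset.mem_image.2 ⟨j, Finset.mem_univ _, hj⟩)
    have : {p : Pt | (∀ j, σ j = i → p ∈ slotDisk s ε q (gadgetModel j)) ∧
        ((∀ j, σ j ≠ i) → p ∉ cellDisk s q)} = (cellDisk s q)ᶜ := by
      ext p
      exact ⟨fun h => h.2 hi', fun h => ⟨fun j hj => absurd hj (hi' j), fun _ => h⟩⟩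
    rw [if_neg hi, one_mul, this]
    exact le_unifSq_real_cellDisk_compl

lemma flipQuad_of_mem_gadgetEvent (hpat : ∀ y : Fin 5 → Pt,
    (∀ i, dist (y i) (modelPattern i) < ε) → FlipPattern (y 0) (y 1) (y 2) (y 3) (y 4))
    (hε0 : 0 < ε) {q : Fin s × Fin s} {σ : Fin 4 ⊕ Fin k → Fin n}
    (hσ : Function.Injective σ) {x : Fin n → Pt} (hx : Function.Injective x)
    (h : x ∈ gadgetEvent ε q σ) :
    FlipQuad (range x) (k + 1) (x (σ (Sum.inl 0))) (x (σ (Sum.inl 1))) (x (σ (Sum.inl 2)))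
      (x (σ (Sum.inl 3))) := by
  have hs := gadgetScale_pos q
  have hback : ∀ p : Pt, cellCenter s q + gadgetScale s • (gadgetScale s)⁻¹ •
      (p - cellCenter s q) = p := by
    intro p
    rw [smul_inv_smul₀ hs.ne', add_sub_cancel]
  have key := flipQuad_of_gadget hpat hε0 (P := range x) (z := cellCenter s q) hs
    (y := fun j => (gadgetScale s)⁻¹ • (x (σ j) - cellCenter s q)) ?_ ?_ ?_ ?_
  · simpa only [hback] using key
  · intro j
    have hj := h.1 j
    rw [slotDisk, Metric.mem_ball, dist_eq_norm] at hj
    have e : (gadgetScale s)⁻¹ • (x (σ j) - cellCenter s q) - gadgetModel j =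
        (gadgetScale s)⁻¹ • (x (σ j) - (cellCenter s q + gadgetScale s • gadgetModel j)) := by
      rw [← sub_sub, smul_sub _ (x (σ j) - cellCenter s q), inv_smul_smul₀ hs.ne']
    rw [dist_eq_norm, e, norm_smul, norm_inv, Real.norm_of_nonneg hs.le,
      inv_mul_lt_iff₀ hs]
    exact hj
  · intro i j hij
    exact hσ (hx (sub_left_injective (smul_right_injective _ (inv_ne_zero hs.ne') hij)))
  · intro j
    rw [hback]
    exact mem_range_self _
  · rintro _ ⟨i, rfl⟩
    by_cases hi : ∀ j, σ j ≠ i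
    · refine Or.inr ⟨(gadgetScale s)⁻¹ • (x i - cellCenter s q), ?_, (hback _).symm⟩
      have hfar := h.2 i hi
      rw [cellDisk, Metric.mem_ball, not_lt, dist_eq_norm] at hfar
      have hn : 10 ≤ ‖(gadgetScale s)⁻¹ • (x i - cellCenter s q)‖ := by
        rw [norm_smul, norm_inv, Real.norm_of_nonneg hs.le, le_inv_mul_iff₀ hs, mul_comm]
        exact hfar
      have hsq : ∀ p : Pt, nsq p = ‖p‖ ^ 2 := fun p => by
        rw [EuclideanSpace.norm_sq_eq, Fin.sum_univ_two]; simp [nsq]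
      rw [hsq]
      nlinarith
    · push Not at hi
      obtain ⟨j, rfl⟩ := hi
      exact Or.inl ⟨j, (hback _).symm⟩

/-- The choice of gadget indices picking the `f j`-th point of the `j`-th block. -/
def blockIndex {N : ℕ} (φ : (Fin 4 ⊕ Fin k) × Fin N → Fin n) (f : Fin 4 ⊕ Fin k → Fin N)
    (j : Fin 4 ⊕ Fin k) : Fin n := φ (j, f j)

variable {N : ℕ} {φ : (Fin 4 ⊕ Fin k) × Fin N → Fin n}

lemma injective_blockIndex (hφ : Function.Injective φ) (f : Fin 4 ⊕ Fin k → Fin N) :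
    Function.Injective (blockIndex φ f) := fun _ _ h => congrArg Prod.fst (hφ h)

lemma eq_of_mem_gadgetEvent (hφ : Function.Injective φ) (hε : ε ≤ 1) {q : Fin s × Fin s}
    {f g : Fin 4 ⊕ Fin k → Fin N} {x : Fin n → Pt} (hf : x ∈ gadgetEvent ε q (blockIndex φ f))
    (hg : x ∈ gadgetEvent ε q (blockIndex φ g)) : f = g := by
  funext j
  by_contra hne
  refine hg.2 (blockIndex φ f j) (fun j' h => hne ?_)
    (slotDisk_subset_cellDisk hε (norm_gadgetModel_le j) (hf.1 j))
  have h' := hφ h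
  obtain rfl : j' = j := congrArg Prod.fst h'
  exact (congrArg Prod.snd h').symm

/-- The number of gadgets in a configuration. -/
def gadgetCount (ε : ℝ) (s : ℕ) (φ : (Fin 4 ⊕ Fin k) × Fin N → Fin n) (x : Fin n → Pt) : ℕ :=
  Nat.card {t : (Fin s × Fin s) × (Fin 4 ⊕ Fin k → Fin N) //
    x ∈ gadgetEvent ε t.1 (blockIndex φ t.2)}

lemma two_pow_gadgetCount_le (hpat : ∀ y : Fin 5 → Pt,
    (∀ i, dist (y i) (modelPattern i) < ε) → FlipPattern (y 0) (y 1) (y 2) (y 3) (y 4))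
    (hε0 : 0 < ε) (hε : ε ≤ 1) (hφ : Function.Injective φ) {x : Fin n → Pt}
    (hx : x ∈ genericConf n) :
    2 ^ gadgetCount ε s φ x ≤ (exactOrderDTs (range x) (k + 1)).ncard + 1 := by
  classical
  rw [gadgetCount, Nat.card_eq_fintype_card]
  have hinj := injective_of_mem_genericConf hx
  let v : {t : (Fin s × Fin s) × (Fin 4 ⊕ Fin k → Fin N) //
    x ∈ gadgetEvent ε t.1 (blockIndex φ t.2)} → Fin 4 → Pt :=
    fun t j => x (blockIndex φ t.1.2 (Sum.inl j))
  have hv : ∀ t j, v t j ∈ cellDisk s t.1.1 := fun t j =>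
    slotDisk_subset_cellDisk hε (norm_gadgetModel_le _) (t.2.1 (Sum.inl j))
  refine two_pow_le_ncard_exactOrderDTs (a := fun t => v t 0) (b := fun t => v t 1)
    (c := fun t => v t 2) (d := fun t => v t 3) (generic_of_mem_genericConf hx)
    (fun t => flipQuad_of_mem_gadgetEvent hpat hε0 (injective_blockIndex hφ _) hinj t.2) ?_
  intro t t' hne p hp hp'
  have hcell : ∀ t, p ∈ ({v t 0, v t 1, v t 2, v t 3} : Finset Pt) → p ∈ cellDisk s t.1.1 := by
    intro t hp
    simp only [Finset.mem_insert, Finset.mem_singleton] at hp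
    rcases hp with rfl | rfl | rfl | rfl <;> exact hv t _
  have hq := cell_eq_of_mem_cellDisk (hcell t hp) (hcell t' hp')
  obtain ⟨⟨q, f⟩, ht⟩ := t
  obtain ⟨⟨q', f'⟩, ht'⟩ := t'
  obtain rfl : q = q' := hq
  exact hne (Subtype.ext (Prod.ext rfl (eq_of_mem_gadgetEvent hφ hε ht ht')))

lemma gadgetCount_eq_sum (x : Fin n → Pt) : (gadgetCount ε s φ x : ℝ) =
    ∑ t : (Fin s × Fin s) × (Fin 4 ⊕ Fin k → Fin N),
      (gadgetEvent ε t.1 (blockIndex φ t.2)).indicator 1 x := by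
  classical
  rw [gadgetCount, Nat.card_eq_fintype_card, Fintype.card_subtype]
  simp [indicator_apply, Finset.sum_boole]

lemma integrable_indicator_gadgetEvent (q : Fin s × Fin s) (σ : Fin 4 ⊕ Fin k → Fin n) :
    Integrable ((gadgetEvent ε q σ).indicator (1 : (Fin n → Pt) → ℝ)) (conf n) :=
  (integrable_const (1 : ℝ)).indicator (measurableSet_gadgetEvent q σ)

lemma integrable_gadgetCount :
    Integrable (fun x => (gadgetCount ε s φ x : ℝ)) (conf n) := by
  simp only [gadgetCount_eq_sum]
  exact integrable_finsetSum _ fun t _ => integrable_indicator_gadgetEvent _ _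

lemma le_integral_gadgetCount (hε0 : 0 < ε) (hε : ε ≤ 1) (hφ : Function.Injective φ) :
    (s : ℝ) ^ 2 * (N : ℝ) ^ (4 + k) * ((Real.pi * (gadgetScale s * ε) ^ 2) ^ (4 + k) *
      (1 - ((s : ℝ) ^ 2)⁻¹) ^ n) ≤ ∫ x, (gadgetCount ε s φ x : ℝ) ∂conf n := by
  simp only [gadgetCount_eq_sum]
  rw [integral_finsetSum _ fun t _ => integrable_indicator_gadgetEvent _ _]
  simp only [integral_indicator_one (measurableSet_gadgetEvent _ _)]
  refine le_trans (le_of_eq ?_) (Finset.card_nsmul_le_sum _ _ _ fun t _ =>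
    le_conf_real_gadgetEvent hε0 hε t.1 (injective_blockIndex hφ t.2))
  simp [nsmul_eq_mul, sq]

/-- Jensen's inequality for the number of triangulations in terms of the number of gadgets. -/
lemma two_rpow_le_integral (hpat : ∀ y : Fin 5 → Pt,
    (∀ i, dist (y i) (modelPattern i) < ε) → FlipPattern (y 0) (y 1) (y 2) (y 3) (y 4))
    (hε0 : 0 < ε) (hε : ε ≤ 1) (hφ : Function.Injective φ) :
    (2 : ℝ) ^ (∫ x, (gadgetCount ε s φ x : ℝ) ∂conf n) - 1 ≤
      ∫ x : Fin n → Pt, ((exactOrderDTs (range x) (k + 1)).ncard : ℝ) ∂conf n := by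
  set M := ∫ x, (gadgetCount ε s φ x : ℝ) ∂conf n with hM
  have hint : Integrable (fun x => (2 : ℝ) ^ M * (1 + ((gadgetCount ε s φ x : ℝ) - M) * Real.log 2)
      - 1) (conf n) :=
    (((integrable_const _).add ((integrable_gadgetCount.sub (integrable_const _)).mul_const
      _)).const_mul _).sub (integrable_const _)
  have heq : ∫ x, ((2 : ℝ) ^ M * (1 + ((gadgetCount ε s φ x : ℝ) - M) * Real.log 2) - 1) ∂conf n =
      (2 : ℝ) ^ M - 1 := by
    have hi := (integrable_gadgetCount (ε := ε) (s := s) (φ := φ)).sub (integrable_const M)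
    have hi2 : Integrable (fun x => ((gadgetCount ε s φ x : ℝ) - M) * Real.log 2) (conf n) :=
      hi.mul_const _
    have hi3 : Integrable (fun x => 1 + ((gadgetCount ε s φ x : ℝ) - M) * Real.log 2) (conf n) :=
      (integrable_const _).add hi2
    rw [integral_sub (hi3.const_mul _) (integrable_const _), integral_const_mul,
      integral_add (integrable_const _) hi2, integral_mul_const,
      integral_sub integrable_gadgetCount (integrable_const _), ← hM]
    simp
  rw [← heq]
  refine integral_mono_ae hint (integrable_ncard_exactOrderDTs n (k + 1)) ?_
  filter_upwards [ae_mem_genericConf n] with x hx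
  have h1 : (2 : ℝ) ^ gadgetCount ε s φ x ≤ (exactOrderDTs (range x) (k + 1)).ncard + 1 := by
    exact_mod_cast two_pow_gadgetCount_le hpat hε0 hε hφ hx
  have h2 : (2 : ℝ) ^ M * (1 + ((gadgetCount ε s φ x : ℝ) - M) * Real.log 2) ≤
      (2 : ℝ) ^ gadgetCount ε s φ x := by
    have e : (2 : ℝ) ^ gadgetCount ε s φ x =
        (2 : ℝ) ^ M * Real.exp (((gadgetCount ε s φ x : ℝ) - M) * Real.log 2) := by
      rw [mul_comm _ (Real.log 2), ← Real.rpow_def_of_pos two_pos,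
        ← Real.rpow_add two_pos, add_sub_cancel, Real.rpow_natCast]
    rw [e]
    refine mul_le_mul_of_nonneg_left ?_ (Real.rpow_nonneg two_pos.le _)
    linarith [Real.add_one_le_exp (((gadgetCount ε s φ x : ℝ) - M) * Real.log 2)]
  linarith

/-- The expected number of triangulations of exact order `k + 1` grows exponentially. -/
lemma exists_two_rpow_le_integral (k : ℕ) : ∃ c : ℝ, 0 < c ∧ ∀ n : ℕ, 4 + k ≤ n →
    (2 : ℝ) ^ (c * n) - 1 ≤
      ∫ x : Fin n → Pt, ((exactOrderDTs (range x) (k + 1)).ncard : ℝ) ∂conf n := by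
  obtain ⟨ε, hε0, hε, hpat⟩ := exists_flipPattern_radius
  set m := 4 + k with hm
  have hpi := Real.pi_pos
  have hm0 : (0 : ℝ) < m := by positivity
  set β := Real.pi * ε ^ 2 / 400 with hβ
  have hβ0 : 0 < β := by positivity
  refine ⟨(β / (16 * m)) ^ m, by positivity, fun n hn => ?_⟩
  set N := n / m
  set s := Nat.sqrt (2 * n) + 1
  have hs1 : 2 * n ≤ s ^ 2 := (Nat.lt_succ_sqrt' (2 * n)).le
  have hs2 : s ^ 2 ≤ 8 * n := by
    have h := Nat.sqrt_le' (2 * n)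
    have h0 : 1 ≤ Nat.sqrt (2 * n) := Nat.le_sqrt.2 (by omega)
    have : s = Nat.sqrt (2 * n) + 1 := rfl
    nlinarith
  have hN : n ≤ 2 * m * N := by
    have h1 := Nat.div_add_mod n m
    have h2 := Nat.mod_lt n (show 0 < m by omega)
    have h3 : 1 ≤ N := (Nat.one_le_div_iff (by omega)).2 hn
    have : N = n / m := rfl
    nlinarith
  obtain ⟨φ⟩ : Nonempty ((Fin 4 ⊕ Fin k) × Fin N ↪ Fin n) := by
    apply Function.Embedding.nonempty_of_card_le
    simpa using Nat.mul_div_le n m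
  refine le_trans (sub_le_sub_right (Real.rpow_le_rpow_of_exponent_le one_le_two ?_) 1)
    (two_rpow_le_integral (s := s) hpat hε0 hε φ.injective)
  refine le_trans ?_ (le_integral_gadgetCount hε0 hε φ.injective)
  have hn0 : (0 : ℝ) < n := by exact_mod_cast (show 0 < n by omega)
  have hs1' : 2 * (n : ℝ) ≤ (s : ℝ) ^ 2 := by exact_mod_cast hs1
  have hs2' : (s : ℝ) ^ 2 ≤ 8 * n := by exact_mod_cast hs2
  have hN' : (n : ℝ) ≤ 2 * m * N := by exact_mod_cast hN
  have hs0 : (0 : ℝ) < (s : ℝ) ^ 2 := by linarith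
  have hbern : (1 / 2 : ℝ) ≤ (1 - ((s : ℝ) ^ 2)⁻¹) ^ n := by
    have h1 : ((s : ℝ) ^ 2)⁻¹ ≤ (2 * (n : ℝ))⁻¹ := inv_anti₀ (by positivity) hs1'
    have h2 : (n : ℝ) * (2 * (n : ℝ))⁻¹ = 1 / 2 := by field_simp
    have h3 : (n : ℝ) * ((s : ℝ) ^ 2)⁻¹ ≤ 1 / 2 := h2 ▸ mul_le_mul_of_nonneg_left h1 hn0.le
    have h4 : ((s : ℝ) ^ 2)⁻¹ ≤ 1 / 2 := by
      refine h1.trans ?_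
      rw [← h2]
      exact le_mul_of_one_le_left (by positivity) (by exact_mod_cast (show 1 ≤ n by omega))
    have h := one_add_mul_le_pow (a := -((s : ℝ) ^ 2)⁻¹) (by linarith) n
    rw [← sub_eq_add_neg] at h
    linarith
  have hb : β / (16 * m) ≤ N * (Real.pi * (gadgetScale s * ε) ^ 2) := by
    have e : Real.pi * (gadgetScale s * ε) ^ 2 = β * ((s : ℝ) ^ 2)⁻¹ := by
      rw [hβ, gadgetScale, mul_pow, inv_pow, mul_pow]
      field_simp
      norm_num
    rw [e, div_le_iff₀ (by positivity), ← div_eq_mul_inv, mul_div_assoc', div_mul_eq_mul_div,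
      le_div_iff₀ hs0]
    nlinarith
  calc (β / (16 * m)) ^ m * n
      ≤ (N * (Real.pi * (gadgetScale s * ε) ^ 2)) ^ m * ((s : ℝ) ^ 2 * (1 / 2)) := by
        gcongr
        linarith
    _ ≤ (N * (Real.pi * (gadgetScale s * ε) ^ 2)) ^ m *
        ((s : ℝ) ^ 2 * (1 - ((s : ℝ) ^ 2)⁻¹) ^ n) := by gcongr
    _ = _ := by rw [mul_pow]; ring

end GadgetEvents

open MeasureTheory Filter in
/-- Theorem 4.4: for every fixed `k ≥ 1` there is a constant `ρ_k > 0` such that, for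
`n` independent uniform points in the unit square, the expected number `E[R_k(n)]` of
order-`k` (and not order-`i` for any `i < k`) Delaunay triangulations satisfies
`liminf (log₂ E[R_k(n)]) / n ≥ ρ_k`. -/
theorem expected_order_k_triangulations_lower_bound (k : ℕ) (hk : 1 ≤ k) :
    ∃ ρ : ℝ, 0 < ρ ∧
      ρ ≤ Filter.liminf
        (fun n : ℕ =>
          Real.logb 2
            (∫ x : Fin n → Pt,
              (({T : Set (Finset Pt) | IsOrderDT (Set.range x) k T ∧
                  ∀ i < k, ¬ IsOrderDT (Set.range x) i T}.ncard : ℝ)) ∂(conf n))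
            / n)
        atTop := by
  obtain ⟨k, rfl⟩ := Nat.exists_eq_add_of_le' hk
  obtain ⟨c, hc, hlow⟩ := exists_two_rpow_le_integral k
  change ∃ ρ : ℝ, 0 < ρ ∧ ρ ≤ liminf (fun n : ℕ => Real.logb 2
    (∫ x : Fin n → Pt, ((exactOrderDTs (range x) (k + 1)).ncard : ℝ) ∂conf n) / n) atTop
  have hlarge : ∀ᶠ n : ℕ in atTop, 4 + k ≤ n ∧ 2 / c ≤ n :=
    (eventually_ge_atTop _).and (tendsto_natCast_atTop_atTop.eventually_ge_atTop _)
  have hexp : ∀ᶠ n : ℕ in atTop, 0 < (n : ℝ) ∧ (2 : ℝ) ^ (c / 2 * n) ≤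
      ∫ x : Fin n → Pt, ((exactOrderDTs (range x) (k + 1)).ncard : ℝ) ∂conf n := by
    filter_upwards [hlarge] with n ⟨hn, hcn⟩
    refine ⟨by exact_mod_cast (show 0 < n by omega), le_trans ?_ (hlow n hn)⟩
    have h1 : (1 : ℝ) ≤ c / 2 * n := by
      rw [div_le_iff₀ hc] at hcn
      linarith
    have h2 : (2 : ℝ) ≤ 2 ^ (c / 2 * n) := by
      simpa using Real.rpow_le_rpow_of_exponent_le one_le_two h1
    have h3 : (2 : ℝ) ^ (c * n) = 2 ^ (c / 2 * n) * 2 ^ (c / 2 * n) := by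
      rw [← Real.rpow_add two_pos]; congr 1; ring
    rw [h3]
    nlinarith
  refine ⟨c / 2, half_pos hc, le_liminf_of_le ?_ ?_⟩
  · refine IsBoundedUnder.isCoboundedUnder_ge ⟨(2 ^ (k + 1 + 3) : ℕ), ?_⟩
    rw [eventually_map]
    filter_upwards [hexp] with n ⟨hn, h⟩
    have hpos := (Real.rpow_pos_of_pos two_pos _).trans_le h
    rw [div_le_iff₀ hn, Real.logb_le_iff_le_rpow one_lt_two hpos, ← Nat.cast_mul,
      Real.rpow_natCast]
    exact integral_ncard_exactOrderDTs_le n (k + 1)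
  · filter_upwards [hexp] with n ⟨hn, h⟩
    have hpos := (Real.rpow_pos_of_pos two_pos _).trans_le h
    rw [le_div_iff₀ hn, Real.le_logb_iff_rpow_le one_lt_two hpos]
    exact h

end
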